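/- arXiv:0911.2627 — 2 statements merged into one kernel-verified Lean document; each statement's English description precedes it below -/
import Mathlib

section
/- (Székely's incidence theorem for graphs of polynomials.) There is an absolute constant C > 0 such that the following holds. Let d ≥ 1 and β ≥ 1 be integers, let P be a finite set of points in ℝ², and let T be a finite set of pairwise distinct one-variable real polynomials, each of degree at most d. Suppose that any two distinct points of P lie simultaneously on the graphs {(x, t(x)) : x ∈ ℝ} of at most β of the polynomials t ∈ T. Then the number of incidences I(P,T) = |{(p,t) ∈ P × T : p lies on the graph of t}| satisfies I(P,T) ≤ C·(d^{1/2} β^{1/3} |P|^{2/3} |T|^{2/3} + |T| + β|P|). -/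
open Finset

section Counting

open Classical

lemma card_image_le_card_breaks_add_one {π γ : Type*} [DecidableEq γ] (J : Finset π) (time : π → ℕ)
    (D : Finset ℕ) (g : π → γ)
    (h : ∀ p ∈ J, ∀ q ∈ J, time p ≤ time q →
      (∀ j ∈ D, time p ≤ j → ¬ j < time q) → g p = g q) :
    (J.image g).card ≤ D.card + 1 := by
  rcases J.eq_empty_or_nonempty with rfl | ⟨p₀, -⟩
  · simp
  have : Nonempty π := ⟨p₀⟩
  have hpre : ∀ c ∈ J.image g, ∃ p ∈ J, g p = c := fun c hc => by simpa using hc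
  choose! r hrJ hr using hpre
  rw [← card_range (D.card + 1)]
  refine card_le_card_of_injOn (fun c => (D.filter (· < time (r c))).card) ?_ ?_
  · intro c _
    simpa [Nat.lt_succ_iff] using card_filter_le _ _
  · have key : ∀ p ∈ J, ∀ q ∈ J, time p ≤ time q →
        (D.filter (· < time p)).card = (D.filter (· < time q)).card → g p = g q := by
      intro p hp q hq hpq hcard
      refine h p hp q hq hpq fun j hj h1 h2 => ?_
      have hsub : D.filter (· < time p) ⊆ D.filter (· < time q) := fun i hi => by
        simp only [mem_filter] at hi ⊢
        exact ⟨hi.1, hi.2.trans_le hpq⟩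
      have heq := eq_of_subset_of_card_le hsub hcard.ge
      have : j ∈ D.filter (· < time p) := heq ▸ mem_filter.2 ⟨hj, h2⟩
      exact absurd (mem_filter.1 this).2 (not_lt.2 h1)
    intro c hc c' hc' hcc
    rw [← hr c hc, ← hr c' hc']
    rcases le_total (time (r c)) (time (r c')) with hle | hle
    · exact key _ (hrJ c hc) _ (hrJ c' hc') hle hcc
    · exact (key _ (hrJ c' hc') _ (hrJ c hc) hle hcc.symm).symm

lemma sum_card_le_of_cells {τ π γ : Type*} [DecidableEq γ] (F : Finset τ) (A : Finset π) (J : τ → Finset π)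
    (hJ : ∀ t ∈ F, J t ⊆ A) (β : ℕ)
    (hβ : ∀ p ∈ A, ∀ q ∈ A, p ≠ q → (F.filter fun t => p ∈ J t ∧ q ∈ J t).card ≤ β)
    (cell : π → γ) {μ : ℝ} (hμ : 0 < μ) :
    ∑ t ∈ F, ((J t).card : ℝ) ≤ ∑ t ∈ F, (((J t).image cell).card : ℝ) +
      μ * ∑ p ∈ A, ((F.filter fun t => cell p ∈ (J t).image cell).card : ℝ) +
      β * A.card / μ := by
  set k : τ → γ → ℕ := fun t c => ((J t).filter fun p => cell p = c).card with hk
  set m : γ → ℕ := fun c => (A.filter fun p => cell p = c).card with hm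
  have hmpos : ∀ c ∈ A.image cell, 0 < (m c : ℝ) := by
    intro c hc
    obtain ⟨p, hp, rfl⟩ := mem_image.1 hc
    exact_mod_cast card_pos.2 ⟨p, by simp [hp]⟩
  have hsub : ∀ t ∈ F, (J t).image cell ⊆ A.image cell := fun t ht => image_subset_image (hJ t ht)
  have hpoint : ∀ t ∈ F, ((J t).card : ℝ) ≤ ((J t).image cell).card +
      μ * ∑ c ∈ (J t).image cell, (m c : ℝ) +
      ∑ c ∈ A.image cell, (k t c : ℝ) * (k t c - 1) / (μ * m c) := by
    intro t ht
    have hnn : ∀ c, 0 ≤ (k t c : ℝ) * (k t c - 1) := by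
      intro c
      rcases Nat.eq_zero_or_pos (k t c) with h | h
      · simp [h]
      · have : (1 : ℝ) ≤ k t c := by exact_mod_cast h
        nlinarith
    have h1 : ((J t).card : ℝ) = ∑ c ∈ (J t).image cell, (k t c : ℝ) := by
      rw [card_eq_sum_card_image cell (J t)]
      push_cast
      rfl
    have h2 : ∑ c ∈ (J t).image cell, (k t c : ℝ) * (k t c - 1) / (μ * m c) ≤
        ∑ c ∈ A.image cell, (k t c : ℝ) * (k t c - 1) / (μ * m c) :=
      sum_le_sum_of_subset_of_nonneg (hsub t ht) fun c _ _ => div_nonneg (hnn c) (by positivity)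
    have h3 : ∑ c ∈ (J t).image cell, (k t c : ℝ) ≤ ∑ c ∈ (J t).image cell,
        (1 + μ * (m c : ℝ) + (k t c : ℝ) * (k t c - 1) / (μ * m c)) := by
      refine sum_le_sum fun c hc => ?_
      have ha : 0 < μ * (m c : ℝ) := mul_pos hμ (hmpos c (hsub t ht hc))
      have hk1 : (1 : ℝ) ≤ k t c := by
        obtain ⟨p, hp, rfl⟩ := mem_image.1 hc
        exact_mod_cast card_pos.2 ⟨p, by simp [hp]⟩
      rw [← sub_le_iff_le_add', le_div_iff₀ ha]
      nlinarith [sq_nonneg ((k t c : ℝ) - 1 - μ * m c)]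
    rw [sum_add_distrib, sum_add_distrib, ← mul_sum] at h3
    simp only [sum_const, nsmul_eq_mul, mul_one] at h3
    linarith
  refine (sum_le_sum hpoint).trans ?_
  rw [sum_add_distrib, sum_add_distrib, ← mul_sum]
  have hmid : ∑ t ∈ F, ∑ c ∈ (J t).image cell, (m c : ℝ) =
      ∑ p ∈ A, ((F.filter fun t => cell p ∈ (J t).image cell).card : ℝ) := by
    have h1 : ∀ t, ∑ c ∈ (J t).image cell, m c =
        (A.filter fun p => cell p ∈ (J t).image cell).card := by
      intro t
      have hmaps : ∀ p ∈ A.filter (fun p => cell p ∈ (J t).image cell),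
          cell p ∈ (J t).image cell := fun p hp => (mem_filter.1 hp).2
      rw [card_eq_sum_card_fiberwise hmaps]
      refine sum_congr rfl fun c hc => ?_
      rw [filter_filter]
      refine congrArg card (filter_congr fun p _ => ?_)
      constructor
      · rintro rfl; exact ⟨hc, rfl⟩
      · exact fun h => h.2
    have h2 := sum_card_bipartiteAbove_eq_sum_card_bipartiteBelow (s := F) (t := A)
      (fun t p => cell p ∈ (J t).image cell)
    simp only [bipartiteAbove, bipartiteBelow] at h2
    have h3 : ∑ t ∈ F, ∑ c ∈ (J t).image cell, m c =
        ∑ p ∈ A, (F.filter fun t => cell p ∈ (J t).image cell).card := by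
      rw [← h2]; exact sum_congr rfl fun t _ => h1 t
    exact_mod_cast h3
  have hlast : ∑ t ∈ F, ∑ c ∈ A.image cell, (k t c : ℝ) * (k t c - 1) / (μ * m c) ≤
      β * A.card / μ := by
    rw [sum_comm]
    have hA : (A.card : ℝ) = ∑ c ∈ A.image cell, (m c : ℝ) := by
      rw [card_eq_sum_card_image cell A]; push_cast; rfl
    rw [hA, mul_sum, sum_div]
    refine sum_le_sum fun c hc => ?_
    rw [← sum_div]
    have hpairs : ∑ t ∈ F, (((J t).filter fun p => cell p = c).offDiag).card ≤
        β * (m c * m c) := by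
      set O := (A.filter fun p => cell p = c).offDiag with hO
      calc ∑ t ∈ F, (((J t).filter fun p => cell p = c).offDiag).card
          ≤ ∑ t ∈ F, (O.filter fun pq => pq.1 ∈ J t ∧ pq.2 ∈ J t).card := by
            refine sum_le_sum fun t ht => card_le_card fun pq hpq => ?_
            simp only [hO, mem_filter, mem_offDiag] at hpq ⊢
            exact ⟨⟨⟨hJ t ht hpq.1.1, hpq.1.2⟩, ⟨hJ t ht hpq.2.1.1, hpq.2.1.2⟩, hpq.2.2⟩,
              hpq.1.1, hpq.2.1.1⟩
        _ = ∑ pq ∈ O, (F.filter fun t => pq.1 ∈ J t ∧ pq.2 ∈ J t).card :=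
            sum_card_bipartiteAbove_eq_sum_card_bipartiteBelow
              (fun t (pq : π × π) => pq.1 ∈ J t ∧ pq.2 ∈ J t)
        _ ≤ ∑ pq ∈ O, β := by
            refine sum_le_sum fun pq hpq => ?_
            simp only [hO, mem_filter, mem_offDiag] at hpq
            exact hβ _ hpq.1.1 _ hpq.2.1.1 hpq.2.2
        _ ≤ β * (m c * m c) := by
            rw [sum_const, smul_eq_mul, mul_comm, hO, offDiag_card]
            exact Nat.mul_le_mul_left _ (Nat.sub_le _ _)
    have hsum : ∑ t ∈ F, (k t c : ℝ) * (k t c - 1) ≤ β * (m c * m c) := by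
      refine le_trans (le_of_eq ?_) (by exact_mod_cast hpairs :
        ((∑ t ∈ F, (((J t).filter fun p => cell p = c).offDiag).card : ℕ) : ℝ) ≤ _)
      push_cast
      refine sum_congr rfl fun t _ => ?_
      rw [offDiag_card, Nat.cast_sub (Nat.le_mul_self _)]
      push_cast
      ring
    have hmc := hmpos c hc
    rw [div_le_div_iff₀ (by positivity) hμ]
    nlinarith [mul_le_mul_of_nonneg_right hsum hμ.le]
  rw [hmid]
  linarith

lemma sum_powersetCard_sdiff_comm {τ : Type*} (T : Finset τ) (r : ℕ)
    (G : Finset τ → τ → ℝ) :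
    ∑ R ∈ T.powersetCard r, ∑ t ∈ T \ R, G R t =
      ∑ S ∈ T.powersetCard (r + 1), ∑ t ∈ S, G (S.erase t) t := by
  rw [sum_sigma', sum_sigma']
  refine sum_bij' (fun x _ => ⟨insert x.2 x.1, x.2⟩) (fun x _ => ⟨x.1.erase x.2, x.2⟩)
    ?_ ?_ ?_ ?_ ?_
  · rintro ⟨R, t⟩ h
    simp only [mem_sigma, mem_powersetCard, mem_sdiff] at h ⊢
    exact ⟨⟨insert_subset h.2.1 h.1.1, by rw [card_insert_of_notMem h.2.2, h.1.2]⟩,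
      mem_insert_self _ _⟩
  · rintro ⟨S, t⟩ h
    simp only [mem_sigma, mem_powersetCard, mem_sdiff] at h ⊢
    exact ⟨⟨(erase_subset _ _).trans h.1.1, by rw [card_erase_of_mem h.2, h.1.2]; rfl⟩,
      h.1.1 h.2, notMem_erase _ _⟩
  · rintro ⟨R, t⟩ h
    simp only [mem_sigma, mem_powersetCard, mem_sdiff] at h
    simp [erase_insert h.2.2]
  · rintro ⟨S, t⟩ h
    simp only [mem_sigma, mem_powersetCard] at h
    simp [insert_erase h.2]
  · rintro ⟨R, t⟩ h
    simp only [mem_sigma, mem_powersetCard, mem_sdiff] at h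
    simp [erase_insert h.2.2]

lemma sum_powersetCard_sum_sdiff {τ : Type*} (T : Finset τ) {r : ℕ} (hr : r ≤ T.card)
    (w : τ → ℝ) :
    (T.card : ℝ) * ∑ R ∈ T.powersetCard r, ∑ t ∈ T \ R, w t =
      (T.card.choose r : ℝ) * ((T.card : ℝ) - r) * ∑ t ∈ T, w t := by
  have h1 : ∑ R ∈ T.powersetCard r, ∑ t ∈ T \ R, w t =
      ∑ t ∈ T, ∑ R ∈ (T.erase t).powersetCard r, w t := by
    refine sum_comm' fun R t => ?_
    simp only [mem_powersetCard, mem_sdiff, subset_erase]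
    tauto
  rw [h1, mul_sum, mul_sum]
  refine sum_congr rfl fun t ht => ?_
  rw [sum_const, card_powersetCard, card_erase_of_mem ht, nsmul_eq_mul, ← mul_assoc]
  congr 1
  obtain ⟨n, hn⟩ : ∃ n, T.card = n + 1 := ⟨T.card - 1, by have := card_pos.2 ⟨t, ht⟩; omega⟩
  have h2 := Nat.choose_mul_succ_eq n r
  rw [hn] at hr ⊢
  rw [← Nat.cast_sub hr, Nat.add_sub_cancel, mul_comm]
  exact_mod_cast h2

end Counting

/-- A finite arrangement of curves seen only through their vertical orders at finitely many times,
together with points whose position relative to the curves is recorded by the sign of `gap`.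
The curves `bot` and `top` are sentinels lying below and above everything. -/
structure CurveSystem (τ π : Type*) (d β : ℕ) where
  curves : Finset τ
  points : Finset π
  steps : ℕ
  height : ℕ → τ → ℝ
  time : π → ℕ
  gap : π → τ → ℝ
  bot : τ
  top : τ
  time_lt : ∀ p ∈ points, time p < steps
  height_injOn : ∀ j < steps, Set.InjOn (height j) curves
  bot_lt : ∀ j < steps, ∀ t ∈ curves, height j bot < height j t
  lt_top : ∀ j < steps, ∀ t ∈ curves, height j t < height j top
  bot_lt_top : ∀ j < steps, height j bot < height j top
  gap_bot : ∀ p ∈ points, gap p bot < 0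
  gap_top : ∀ p ∈ points, 0 < gap p top
  height_lt_of_gap_lt : ∀ p ∈ points, ∀ s t, (s ∈ curves ∨ s = bot ∨ s = top) →
    (t ∈ curves ∨ t = bot ∨ t = top) → gap p s < gap p t → height (time p) s < height (time p) t
  card_flips_le : ∀ s ∈ curves, ∀ t ∈ curves, s ≠ t →
    {j : ℕ | j + 1 < steps ∧
      ((height j s < height j t ∧ height (j + 1) t < height (j + 1) s) ∨
      (height j t < height j s ∧ height (j + 1) s < height (j + 1) t))}.ncard ≤ d
  card_meet_le : ∀ s ∈ curves, ∀ t ∈ curves, s ≠ t →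
    {p | p ∈ points ∧ gap p s = 0 ∧ gap p t = 0}.ncard ≤ d
  card_common_le : ∀ p ∈ points, ∀ q ∈ points, p ≠ q →
    {t | t ∈ curves ∧ gap p t = 0 ∧ gap q t = 0}.ncard ≤ β

namespace CurveSystem

open Classical

variable {τ π : Type*} {d β : ℕ} (X : CurveSystem τ π d β)

/-- Adds the two sentinels to a family of curves. -/
noncomputable def hat (R : Finset τ) : Finset τ := insert X.bot (insert X.top R)

/-- `l` and `u` are vertically consecutive in `Q` at time `j`. -/
def Adj (Q : Finset τ) (j : ℕ) (l u : τ) : Prop :=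
  X.height j l < X.height j u ∧ ∀ s ∈ Q, X.height j s ≤ X.height j l ∨ X.height j u ≤ X.height j s

/-- `p` lies on no curve of `Q`. -/
def Free (Q : Finset τ) (p : π) : Prop := ∀ s ∈ Q, X.gap p s ≠ 0

/-- `p` and `q` lie in the same cell of the vertical decomposition of `Q`. -/
def Same (Q : Finset τ) (p q : π) : Prop :=
  ∃ l ∈ Q, ∃ u ∈ Q, (X.gap p l < 0 ∧ 0 < X.gap p u) ∧ (X.gap q l < 0 ∧ 0 < X.gap q u) ∧
    ∀ j ∈ Set.uIcc (X.time p) (X.time q), X.Adj Q j l u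

/-- The points in the cell of `p`. -/
noncomputable def cell (Q : Finset τ) (p : π) : Finset π := X.points.filter (X.Same Q p)

/-- The order of `s` and `t` is reversed between the times `j` and `j + 1`. -/
def Flip (j : ℕ) (s t : τ) : Prop :=
  (X.height j s < X.height j t ∧ X.height (j + 1) t < X.height (j + 1) s) ∨
  (X.height j t < X.height j s ∧ X.height (j + 1) s < X.height (j + 1) t)

/-- The incident points of `t` lying on no curve of `R`. -/
noncomputable def freePoints (R : Finset τ) (t : τ) : Finset π :=
  X.points.filter fun p => X.Free (X.hat R) p ∧ X.gap p t = 0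

/-- The times after which `t` changes one of its two neighbours in `S`. -/
noncomputable def breaks (S : Finset τ) (t : τ) : Finset ℕ :=
  (range (X.steps - 1)).filter fun j => ∃ v ∈ X.hat S,
    (X.Adj (X.hat S) j v t ∧ ¬ X.Adj (X.hat S) (j + 1) v t) ∨
    (X.Adj (X.hat S) j t v ∧ ¬ X.Adj (X.hat S) (j + 1) t v)

variable {X}

lemma mem_hat {R : Finset τ} {s : τ} : s ∈ X.hat R ↔ s ∈ R ∨ s = X.bot ∨ s = X.top := by
  simp only [hat, mem_insert]; tauto

lemma hat_mono {R S : Finset τ} (h : R ⊆ S) : X.hat R ⊆ X.hat S :=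
  insert_subset_insert _ (insert_subset_insert _ h)

lemma bot_mem_hat {R : Finset τ} : X.bot ∈ X.hat R := mem_hat.2 (.inr (.inl rfl))

lemma top_mem_hat {R : Finset τ} : X.top ∈ X.hat R := mem_hat.2 (.inr (.inr rfl))

lemma height_injOn_hat {j : ℕ} (hj : j < X.steps) :
    Set.InjOn (X.height j) (X.hat X.curves) := by
  intro s hs t ht hst
  have hbt := X.bot_lt_top j hj
  rcases mem_hat.1 hs with hs | rfl | rfl <;> rcases mem_hat.1 ht with ht | rfl | rfl
  · exact X.height_injOn j hj hs ht hst
  · exact absurd hst (X.bot_lt j hj s hs).ne'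
  · exact absurd hst (X.lt_top j hj s hs).ne
  · exact absurd hst (X.bot_lt j hj t ht).ne
  · rfl
  · exact absurd hst hbt.ne
  · exact absurd hst (X.lt_top j hj t ht).ne'
  · exact absurd hst hbt.ne'
  · rfl

lemma height_lt {p : π} (hp : p ∈ X.points) {s t : τ} (hs : s ∈ X.hat X.curves)
    (ht : t ∈ X.hat X.curves) (h : X.gap p s < X.gap p t) :
    X.height (X.time p) s < X.height (X.time p) t :=
  X.height_lt_of_gap_lt p hp s t (mem_hat.1 hs) (mem_hat.1 ht) h

lemma ne_sentinel {p : π} (hp : p ∈ X.points) {t : τ} (ht : t ∈ X.curves) :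
    t ≠ X.bot ∧ t ≠ X.top := by
  have hj := X.time_lt p hp
  constructor
  · rintro rfl; exact lt_irrefl _ (X.bot_lt _ hj _ ht)
  · rintro rfl; exact lt_irrefl _ (X.lt_top _ hj _ ht)

lemma Adj.right_unique {Q : Finset τ} {j : ℕ} (hj : j < X.steps) (hQ : Q ⊆ X.hat X.curves)
    {v t t' : τ} (ht : t ∈ Q) (ht' : t' ∈ Q) (h : X.Adj Q j v t) (h' : X.Adj Q j v t') :
    t = t' := by
  refine height_injOn_hat hj (hQ ht) (hQ ht') (le_antisymm ?_ ?_)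
  · exact (h.2 t' ht').resolve_left (not_le.2 h'.1)
  · exact (h'.2 t ht).resolve_left (not_le.2 h.1)

lemma Adj.left_unique {Q : Finset τ} {j : ℕ} (hj : j < X.steps) (hQ : Q ⊆ X.hat X.curves)
    {v t t' : τ} (ht : t ∈ Q) (ht' : t' ∈ Q) (h : X.Adj Q j t v) (h' : X.Adj Q j t' v) :
    t = t' := by
  refine height_injOn_hat hj (hQ ht) (hQ ht') (le_antisymm ?_ ?_)
  · exact (h'.2 t ht).resolve_right (not_le.2 h.1)
  · exact (h.2 t' ht').resolve_right (not_le.2 h'.1)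

lemma exists_adj_left {Q : Finset τ} {j : ℕ} {t b : τ} (hb : b ∈ Q) (hbt : X.height j b < X.height j t) :
    ∃ l ∈ Q, X.Adj Q j l t := by
  obtain ⟨l, hl, hmax⟩ := exists_max_image (Q.filter fun s => X.height j s < X.height j t)
    (X.height j) ⟨b, mem_filter.2 ⟨hb, hbt⟩⟩
  rw [mem_filter] at hl
  refine ⟨l, hl.1, hl.2, fun s hs => ?_⟩
  by_cases h : X.height j s < X.height j t
  · exact .inl (hmax s (mem_filter.2 ⟨hs, h⟩))
  · exact .inr (not_lt.1 h)

lemma exists_adj_right {Q : Finset τ} {j : ℕ} {t b : τ} (hb : b ∈ Q) (hbt : X.height j t < X.height j b) :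
    ∃ u ∈ Q, X.Adj Q j t u := by
  obtain ⟨u, hu, hmin⟩ := exists_min_image (Q.filter fun s => X.height j t < X.height j s)
    (X.height j) ⟨b, mem_filter.2 ⟨hb, hbt⟩⟩
  rw [mem_filter] at hu
  refine ⟨u, hu.1, hu.2, fun s hs => ?_⟩
  by_cases h : X.height j t < X.height j s
  · exact .inr (hmin s (mem_filter.2 ⟨hs, h⟩))
  · exact .inl (not_lt.1 h)

lemma Free.same_self {Q : Finset τ} (hQ : Q ⊆ X.hat X.curves) (hb : X.bot ∈ Q) (ht : X.top ∈ Q)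
    {p : π} (hp : p ∈ X.points) (h : X.Free Q p) : X.Same Q p p := by
  obtain ⟨l, hl, hmax⟩ := exists_max_image (Q.filter fun s => X.gap p s < 0)
    (X.height (X.time p)) ⟨X.bot, mem_filter.2 ⟨hb, X.gap_bot p hp⟩⟩
  obtain ⟨u, hu, hmin⟩ := exists_min_image (Q.filter fun s => 0 < X.gap p s)
    (X.height (X.time p)) ⟨X.top, mem_filter.2 ⟨ht, X.gap_top p hp⟩⟩
  rw [mem_filter] at hl hu
  refine ⟨l, hl.1, u, hu.1, ⟨hl.2, hu.2⟩, ⟨hl.2, hu.2⟩, fun j hj => ?_⟩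
  rw [Set.uIcc_self, Set.mem_singleton_iff] at hj
  subst hj
  refine ⟨height_lt hp (hQ hl.1) (hQ hu.1) (hl.2.trans hu.2), fun s hs => ?_⟩
  rcases lt_or_gt_of_ne (h s hs) with hneg | hpos
  · exact .inl (hmax s (mem_filter.2 ⟨hs, hneg⟩))
  · exact .inr (hmin s (mem_filter.2 ⟨hs, hpos⟩))

lemma Same.symm {Q : Finset τ} {p q : π} (h : X.Same Q p q) : X.Same Q q p := by
  obtain ⟨l, hl, u, hu, hp, hq, hadj⟩ := h
  exact ⟨l, hl, u, hu, hq, hp, by rwa [Set.uIcc_comm]⟩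

/-- The floor and the ceiling of a point are the same for two families containing them all. -/
lemma adj_unique_of_gap {Q Q' : Finset τ} (hQ : Q ⊆ X.hat X.curves) (hQ' : Q' ⊆ X.hat X.curves)
    {p : π} (hp : p ∈ X.points) {l u l' u' : τ} (hl : l ∈ Q') (hu : u ∈ Q') (hl' : l' ∈ Q)
    (hu' : u' ∈ Q) (hgl : X.gap p l < 0) (hgu : 0 < X.gap p u) (hgl' : X.gap p l' < 0)
    (hgu' : 0 < X.gap p u') (h : X.Adj Q (X.time p) l u) (h' : X.Adj Q' (X.time p) l' u') :
    l = l' ∧ u = u' := by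
  have hj := X.time_lt p hp
  have hlu' := height_lt hp (hQ' hl) (hQ hu') (hgl.trans hgu')
  have hl'u := height_lt hp (hQ hl') (hQ' hu) (hgl'.trans hgu)
  refine ⟨height_injOn_hat hj (hQ' hl) (hQ hl') (le_antisymm ?_ ?_),
    height_injOn_hat hj (hQ' hu) (hQ hu') (le_antisymm ?_ ?_)⟩
  · exact (h'.2 l hl).resolve_right (not_le.2 hlu')
  · exact (h.2 l' hl').resolve_right (not_le.2 hl'u)
  · exact (h.2 u' hu').resolve_left (not_le.2 hlu')
  · exact (h'.2 u hu).resolve_left (not_le.2 hl'u)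

lemma Same.trans {Q : Finset τ} (hQ : Q ⊆ X.hat X.curves) {p q r : π} (hq : q ∈ X.points)
    (h : X.Same Q p q) (h' : X.Same Q q r) : X.Same Q p r := by
  obtain ⟨l, hl, u, hu, hp, hql, hadj⟩ := h
  obtain ⟨l', hl', u', hu', hql', hr, hadj'⟩ := h'
  obtain ⟨rfl, rfl⟩ := adj_unique_of_gap hQ hQ hq hl hu hl' hu' hql.1 hql.2 hql'.1 hql'.2
    (hadj _ Set.right_mem_uIcc) (hadj' _ Set.left_mem_uIcc)
  refine ⟨l, hl, u, hu, hp, hr, fun j hj => ?_⟩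
  rcases Set.uIcc_subset_uIcc_union_uIcc hj with hj | hj
  exacts [hadj j hj, hadj' j hj]

lemma Same.cell_eq {Q : Finset τ} (hQ : Q ⊆ X.hat X.curves) {p q : π} (hp : p ∈ X.points)
    (hq : q ∈ X.points) (h : X.Same Q p q) : X.cell Q p = X.cell Q q :=
  filter_congr fun _ _ => ⟨h.symm.trans hQ hp, h.trans hQ hq⟩

lemma Free.same_of_cell_eq {Q : Finset τ} (hQ : Q ⊆ X.hat X.curves) (hb : X.bot ∈ Q)
    (ht : X.top ∈ Q) {p q : π} (hq : q ∈ X.points) (hf : X.Free Q q)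
    (h : X.cell Q p = X.cell Q q) : X.Same Q p q := by
  have : q ∈ X.cell Q p := h ▸ mem_filter.2 ⟨hq, hf.same_self hQ hb ht hq⟩
  exact (mem_filter.1 this).2

lemma hat_erase {S : Finset τ} {p : π} (hp : p ∈ X.points) (hS : S ⊆ X.curves) {t : τ}
    (ht : t ∈ S) : X.hat (S.erase t) = (X.hat S).erase t := by
  have := ne_sentinel hp (hS ht)
  ext s
  simp only [mem_hat, mem_erase]
  constructor
  · rintro (h | rfl | rfl)
    exacts [⟨h.1, .inl h.2⟩, ⟨this.1.symm, by simp⟩, ⟨this.2.symm, by simp⟩]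
  · rintro ⟨h, h' | h' | h'⟩ <;> simp [*]

/-- A curve keeping both neighbours in `S` between two of its incident points stays in one cell
of the other curves of `S`. -/
lemma same_of_no_breaks {S : Finset τ} (hS : S ⊆ X.curves) {t : τ} (ht : t ∈ S) {p q : π}
    (hp : p ∈ X.freePoints (S.erase t) t) (hq : q ∈ X.freePoints (S.erase t) t)
    (hpq : X.time p ≤ X.time q)
    (h : ∀ j ∈ X.breaks S t, X.time p ≤ j → ¬ j < X.time q) :
    X.Same (X.hat (S.erase t)) p q := by
  simp only [freePoints, mem_filter] at hp hq
  obtain ⟨hp, hpf, hpt⟩ := hp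
  obtain ⟨hq, hqf, hqt⟩ := hq
  have hSh : X.hat S ⊆ X.hat X.curves := hat_mono hS
  have htS : t ∈ X.hat S := mem_hat.2 (.inl ht)
  have hjp := X.time_lt p hp
  have hjq := X.time_lt q hq
  obtain ⟨l, hl, hlt⟩ := exists_adj_left bot_mem_hat (X.bot_lt _ hjp t (hS ht))
  obtain ⟨u, hu, htu⟩ := exists_adj_right top_mem_hat (X.lt_top _ hjp t (hS ht))
  have hadj : ∀ j, X.time p ≤ j → j ≤ X.time q →
      X.Adj (X.hat S) j l t ∧ X.Adj (X.hat S) j t u := by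
    intro j hj
    induction j, hj using Nat.le_induction with
    | base => exact fun _ => ⟨hlt, htu⟩
    | succ j hj ih =>
      intro hjq'
      obtain ⟨h1, h2⟩ := ih (by omega)
      by_contra hcon
      refine h j (mem_filter.2 ⟨mem_range.2 (by omega), ?_⟩) hj (by omega)
      by_cases h3 : X.Adj (X.hat S) (j + 1) l t
      · exact ⟨u, hu, .inr ⟨h2, fun h4 => hcon ⟨h3, h4⟩⟩⟩
      · exact ⟨l, hl, .inl ⟨h1, h3⟩⟩
  rw [hat_erase hp hS ht] at hpf hqf ⊢
  have hlR : l ∈ (X.hat S).erase t := mem_erase.2 ⟨fun h => (h ▸ hlt.1).false, hl⟩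
  have huR : u ∈ (X.hat S).erase t := mem_erase.2 ⟨fun h => (h ▸ htu.1).false, hu⟩
  have hgap : ∀ r ∈ X.points, X.Free ((X.hat S).erase t) r → X.gap r t = 0 →
      X.Adj (X.hat S) (X.time r) l t → X.Adj (X.hat S) (X.time r) t u →
      X.gap r l < 0 ∧ 0 < X.gap r u := by
    intro r hr hf hrt h1 h2
    constructor
    · refine (lt_or_gt_of_ne (hf l hlR)).resolve_right fun hpos => ?_
      exact lt_asymm h1.1 (height_lt hr (hSh htS) (hSh hl) (hrt ▸ hpos))
    · refine (lt_or_gt_of_ne (hf u huR)).resolve_left fun hneg => ?_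
      exact lt_asymm h2.1 (height_lt hr (hSh hu) (hSh htS) (hrt ▸ hneg))
  obtain ⟨hq1, hq2⟩ := hadj _ hpq le_rfl
  refine ⟨l, hlR, u, huR, hgap p hp hpf hpt hlt htu, hgap q hq hqf hqt hq1 hq2, fun j hj => ?_⟩
  rw [Set.uIcc_of_le hpq] at hj
  obtain ⟨h1, h2⟩ := hadj j hj.1 hj.2
  refine ⟨h1.1.trans h2.1, fun s hs => ?_⟩
  rw [mem_erase] at hs
  rcases h1.2 s hs.2 with h3 | h3
  · exact .inl h3
  rcases h2.2 s hs.2 with h4 | h4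
  · exact absurd (height_injOn_hat (hj.2.trans_lt hjq) (hSh hs.2) (hSh htS) (le_antisymm h4 h3))
      hs.1
  · exact .inr h4

lemma card_image_cell_le {S : Finset τ} (hS : S ⊆ X.curves) {t : τ} (ht : t ∈ S) :
    ((X.freePoints (S.erase t) t).image (X.cell (X.hat (S.erase t)))).card ≤
      (X.breaks S t).card + 1 :=
  card_image_le_card_breaks_add_one _ X.time _ _ fun _ hp _ hq hpq h =>
    (same_of_no_breaks hS ht hp hq hpq h).cell_eq (hat_mono ((erase_subset _ _).trans hS))
      (mem_filter.1 hp).1 (mem_filter.1 hq).1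

lemma Flip.symm {j : ℕ} {s t : τ} (h : X.Flip j s t) : X.Flip j t s := Or.symm h

lemma Flip.mem {j : ℕ} (hj : j + 1 < X.steps) {S : Finset τ} (hS : S ⊆ X.curves) {s t : τ}
    (hs : s ∈ X.hat S) (ht : t ∈ X.hat S) (h : X.Flip j s t) : s ∈ S := by
  have hj' : j < X.steps := by omega
  have hb : ∀ i < X.steps, ∀ v ∈ X.hat S, X.height i X.bot ≤ X.height i v := by
    intro i hi v hv
    rcases mem_hat.1 hv with hv | rfl | rfl
    exacts [(X.bot_lt i hi v (hS hv)).le, le_rfl, (X.bot_lt_top i hi).le]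
  have ht' : ∀ i < X.steps, ∀ v ∈ X.hat S, X.height i v ≤ X.height i X.top := by
    intro i hi v hv
    rcases mem_hat.1 hv with hv | rfl | rfl
    exacts [(X.lt_top i hi v (hS hv)).le, (X.bot_lt_top i hi).le, le_rfl]
  rcases mem_hat.1 hs with hs | rfl | rfl
  · exact hs
  · rcases h with h | h
    · exact absurd h.2 (not_lt.2 (hb _ hj t ht))
    · exact absurd h.1 (not_lt.2 (hb _ hj' t ht))
  · rcases h with h | h
    · exact absurd h.1 (not_lt.2 (ht' _ hj' t ht))
    · exact absurd h.2 (not_lt.2 (ht' _ hj t ht))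

lemma Adj.exists_flip {Q : Finset τ} (hQ : Q ⊆ X.hat X.curves) {j : ℕ} (hj : j + 1 < X.steps)
    {l u : τ} (hl : l ∈ Q) (hu : u ∈ Q) (h : X.Adj Q j l u) (h' : ¬ X.Adj Q (j + 1) l u) :
    (∃ s ∈ Q, X.Flip j l s) ∨ ∃ s ∈ Q, X.Flip j u s := by
  by_cases hlu : X.height (j + 1) l < X.height (j + 1) u
  · have : ∃ s ∈ Q, X.height (j + 1) l < X.height (j + 1) s ∧
        X.height (j + 1) s < X.height (j + 1) u := by
      by_contra! hcon
      exact h' ⟨hlu, fun s hs => (le_or_gt _ _).imp_right (hcon s hs)⟩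
    obtain ⟨s, hs, h1, h2⟩ := this
    have hj' : j < X.steps := by omega
    rcases h.2 s hs with h3 | h3
    · refine .inl ⟨s, hs, .inr ⟨lt_of_le_of_ne h3 fun he => ?_, h1⟩⟩
      exact (height_injOn_hat hj' (hQ hs) (hQ hl) he ▸ h1).false
    · refine .inr ⟨s, hs, .inl ⟨lt_of_le_of_ne h3 fun he => ?_, h2⟩⟩
      exact (height_injOn_hat hj' (hQ hu) (hQ hs) he ▸ h2).false
  · refine .inl ⟨u, hu, .inl ⟨h.1, lt_of_le_of_ne (not_lt.1 hlu) fun he => ?_⟩⟩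
    exact (height_injOn_hat hj (hQ hu) (hQ hl) he ▸ h.1).false

lemma card_breaking_le {S : Finset τ} (hS : S ⊆ X.curves) {j : ℕ} (hj : j + 1 < X.steps) :
    (S.filter fun t => j ∈ X.breaks S t).card ≤
      3 * (S.offDiag.filter fun st => X.Flip j st.1 st.2).card := by
  set F := S.filter fun v => ∃ s ∈ X.hat S, X.Flip j v s with hF
  have hSh : X.hat S ⊆ X.hat X.curves := hat_mono hS
  have hj' : j < X.steps := by omega
  have hFcard : F.card ≤ (S.offDiag.filter fun st => X.Flip j st.1 st.2).card := by
    refine le_trans (card_le_card fun v hv => ?_) (card_image_le (f := Prod.fst))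
    obtain ⟨hvS, s, hs, hvs⟩ := mem_filter.1 hv
    have hsS := hvs.symm.mem hj hS hs (mem_hat.2 (.inl hvS))
    refine mem_image.2 ⟨(v, s), mem_filter.2 ⟨mem_offDiag.2 ⟨hvS, hsS, ?_⟩, hvs⟩, rfl⟩
    intro he
    obtain rfl : v = s := he
    rcases hvs with h | h <;> exact h.1.false
  have h1 : (S.filter fun t => ∃ v ∈ F, X.Adj (X.hat S) j v t).card ≤ F.card := by
    refine card_le_card_of_forall_subsingleton (fun t v => X.Adj (X.hat S) j v t)
      (fun t ht => (mem_filter.1 ht).2) fun v _ t ht t' ht' => ?_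
    exact ht.2.right_unique hj' hSh (mem_hat.2 (.inl (mem_filter.1 ht.1).1))
      (mem_hat.2 (.inl (mem_filter.1 ht'.1).1)) ht'.2
  have h2 : (S.filter fun t => ∃ v ∈ F, X.Adj (X.hat S) j t v).card ≤ F.card := by
    refine card_le_card_of_forall_subsingleton (fun t v => X.Adj (X.hat S) j t v)
      (fun t ht => (mem_filter.1 ht).2) fun v _ t ht t' ht' => ?_
    exact ht.2.left_unique hj' hSh (mem_hat.2 (.inl (mem_filter.1 ht.1).1))
      (mem_hat.2 (.inl (mem_filter.1 ht'.1).1)) ht'.2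
  have hsub : (S.filter fun t => j ∈ X.breaks S t) ⊆
      F ∪ ((S.filter fun t => ∃ v ∈ F, X.Adj (X.hat S) j v t) ∪
        (S.filter fun t => ∃ v ∈ F, X.Adj (X.hat S) j t v)) := by
    intro t ht
    obtain ⟨htS, hbr⟩ := mem_filter.1 ht
    obtain ⟨-, v, hv, hbr⟩ := mem_filter.1 hbr
    have htS' : t ∈ X.hat S := mem_hat.2 (.inl htS)
    have hvF : (∃ s ∈ X.hat S, X.Flip j v s) → v ∈ F := fun ⟨s, hs, h⟩ =>
      mem_filter.2 ⟨h.mem hj hS hv hs, s, hs, h⟩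
    simp only [mem_union, mem_filter]
    rcases hbr with ⟨ha, hb⟩ | ⟨ha, hb⟩
    · rcases ha.exists_flip hSh hj hv htS' hb with h | h
      · exact .inr (.inl ⟨htS, v, hvF h, ha⟩)
      · exact .inl (mem_filter.2 ⟨htS, h⟩)
    · rcases ha.exists_flip hSh hj htS' hv hb with h | h
      · exact .inl (mem_filter.2 ⟨htS, h⟩)
      · exact .inr (.inr ⟨htS, v, hvF h, ha⟩)
  have h3 := card_le_card hsub
  have h4 := card_union_le F ((S.filter fun t => ∃ v ∈ F, X.Adj (X.hat S) j v t) ∪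
        (S.filter fun t => ∃ v ∈ F, X.Adj (X.hat S) j t v))
  have h5 := card_union_le (S.filter fun t => ∃ v ∈ F, X.Adj (X.hat S) j v t)
        (S.filter fun t => ∃ v ∈ F, X.Adj (X.hat S) j t v)
  omega

lemma sum_card_breaks_le {S : Finset τ} (hS : S ⊆ X.curves) :
    ∑ t ∈ S, (X.breaks S t).card ≤ 3 * (d * (S.card * S.card - S.card)) := by
  have h1 : ∑ t ∈ S, (X.breaks S t).card =
      ∑ j ∈ range (X.steps - 1), (S.filter fun t => j ∈ X.breaks S t).card := by
    have := sum_card_bipartiteAbove_eq_sum_card_bipartiteBelow (s := S)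
      (t := range (X.steps - 1)) (fun t j => j ∈ X.breaks S t)
    simp only [bipartiteAbove, bipartiteBelow] at this
    rw [← this]
    refine sum_congr rfl fun t _ => congrArg card ?_
    ext j
    simp only [mem_filter, iff_and_self]
    exact fun h => (mem_filter.1 h).1
  have h2 : ∑ j ∈ range (X.steps - 1), (S.offDiag.filter fun st => X.Flip j st.1 st.2).card =
      ∑ st ∈ S.offDiag, ((range (X.steps - 1)).filter fun j => X.Flip j st.1 st.2).card :=
    sum_card_bipartiteAbove_eq_sum_card_bipartiteBelow
      (fun j (st : τ × τ) => X.Flip j st.1 st.2)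
  calc ∑ t ∈ S, (X.breaks S t).card
      ≤ ∑ j ∈ range (X.steps - 1),
          3 * (S.offDiag.filter fun st => X.Flip j st.1 st.2).card := by
        rw [h1]
        exact sum_le_sum fun j hj => card_breaking_le hS (by have := mem_range.1 hj; omega)
    _ = 3 * ∑ st ∈ S.offDiag,
          ((range (X.steps - 1)).filter fun j => X.Flip j st.1 st.2).card := by
        rw [← mul_sum, h2]
    _ ≤ 3 * ∑ st ∈ S.offDiag, d := by
        refine Nat.mul_le_mul_left _ (sum_le_sum fun st hst => ?_)
        obtain ⟨hs, ht, hne⟩ := mem_offDiag.1 hst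
        rw [← Set.ncard_coe_finset]
        refine le_trans (le_of_eq (congrArg Set.ncard ?_))
          (X.card_flips_le _ (hS hs) _ (hS ht) hne)
        ext j
        rw [mem_coe, mem_filter, mem_range, Nat.lt_sub_iff_add_lt]
        rfl
    _ = 3 * (d * (S.card * S.card - S.card)) := by
        rw [sum_const, offDiag_card, smul_eq_mul, mul_comm d]

/-- Backward analysis: only boundedly many curves of `S` meet, at an incident point, the cell that
a given point has once the curve is removed from `S`. -/
lemma card_cell_mem_image_le {S : Finset τ} (hS : S ⊆ X.curves) {p : π} (hp : p ∈ X.points) :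
    (S.filter fun t => X.Free (X.hat (S.erase t)) p ∧ X.cell (X.hat (S.erase t)) p ∈
      (X.freePoints (S.erase t) t).image (X.cell (X.hat (S.erase t)))).card ≤ 5 := by
  set B := S.filter fun t => X.Free (X.hat (S.erase t)) p ∧ X.cell (X.hat (S.erase t)) p ∈
      (X.freePoints (S.erase t) t).image (X.cell (X.hat (S.erase t))) with hB
  have hSh : X.hat S ⊆ X.hat X.curves := hat_mono hS
  have hBmem : ∀ t ∈ B, t ∈ S ∧ X.Free ((X.hat S).erase t) p ∧
      ∃ q ∈ X.points, X.gap q t = 0 ∧ X.Same ((X.hat S).erase t) p q := by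
    intro t ht
    obtain ⟨htS, hf, himg⟩ := mem_filter.1 ht
    obtain ⟨q, hq, hqc⟩ := mem_image.1 himg
    obtain ⟨hqP, hqf, hqt⟩ := mem_filter.1 hq
    have hsame := hqf.same_of_cell_eq (hat_mono ((erase_subset _ _).trans hS)) bot_mem_hat
      top_mem_hat hqP hqc.symm
    rw [hat_erase hp hS htS] at hf hsame
    exact ⟨htS, hf, q, hqP, hqt, hsame⟩
  by_cases hinc : ∃ t ∈ B, X.gap p t = 0
  · obtain ⟨t, ht, hpt⟩ := hinc
    refine le_trans (card_le_one.2 ?_) (by norm_num : 1 ≤ 5)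
    have huniq : ∀ t' ∈ B, t' = t := by
      intro t' ht'
      by_contra hne
      exact (hBmem t' ht').2.1 t
        (mem_erase.2 ⟨Ne.symm hne, mem_hat.2 (.inl (hBmem t ht).1)⟩) hpt
    exact fun a ha b hb => (huniq a ha).trans (huniq b hb).symm
  · push Not at hinc
    rcases B.eq_empty_or_nonempty with hBe | ⟨t₀, ht₀⟩
    · simp [hBe]
    have hfree : X.Free (X.hat S) p := by
      intro s hs
      by_cases h : s = t₀
      · exact h ▸ hinc t₀ ht₀
      · exact (hBmem t₀ ht₀).2.1 s (mem_erase.2 ⟨h, hs⟩)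
    obtain ⟨l, hl, u, hu, ⟨hpl, hpu⟩, -, hadj⟩ := hfree.same_self hSh bot_mem_hat top_mem_hat hp
    replace hadj := hadj _ Set.left_mem_uIcc
    have hmeet : ∀ t ∈ B, t ≠ l → t ≠ u → ∃ q ∈ X.points,
        (X.height (X.time q) l < X.height (X.time q) t ∧
          X.height (X.time q) t < X.height (X.time q) u) ∧
        ∀ j ∈ Set.uIcc (X.time p) (X.time q), X.Adj ((X.hat S).erase t) j l u := by
      intro t ht htl htu
      obtain ⟨htS, -, q, hq, hqt, l', hl', u', hu', hpl', hql', hadj'⟩ := hBmem t ht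
      have hsub : (X.hat S).erase t ⊆ X.hat S := erase_subset _ _
      obtain ⟨rfl, rfl⟩ := adj_unique_of_gap hSh (hsub.trans hSh) hp
        (mem_erase.2 ⟨htl.symm, hl⟩) (mem_erase.2 ⟨htu.symm, hu⟩) (hsub hl') (hsub hu')
        hpl hpu hpl'.1 hpl'.2 hadj (hadj' _ Set.left_mem_uIcc)
      have htS' : t ∈ X.hat X.curves := mem_hat.2 (.inl (hS htS))
      exact ⟨q, hq, ⟨height_lt hq (hSh hl) htS' (hqt ▸ hql'.1),
        height_lt hq htS' (hSh hu) (hqt ▸ hql'.2)⟩, hadj'⟩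
    have : Nonempty π := ⟨p⟩
    choose! q hqP hqt hqadj using hmeet
    set B' := (B.erase l).erase u with hB'
    have hB'mem : ∀ t ∈ B', t ∈ B ∧ t ≠ l ∧ t ≠ u := by
      intro t ht
      simp only [hB', mem_erase] at ht
      exact ⟨ht.2.2, ht.2.1, ht.1⟩
    have hnest : ∀ t ∈ B', ∀ t' ∈ B',
        X.time (q t) ∈ Set.uIcc (X.time p) (X.time (q t')) → t = t' := by
      intro t ht t' ht' hmem
      obtain ⟨htB, htl, htu⟩ := hB'mem t ht
      obtain ⟨htB', htl', htu'⟩ := hB'mem t' ht'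
      by_contra hne
      have h1 := hqt t htB htl htu
      rcases (hqadj t' htB' htl' htu' _ hmem).2 t
        (mem_erase.2 ⟨hne, mem_hat.2 (.inl (hBmem t htB).1)⟩) with h | h
      · exact absurd h1.1 (not_lt.2 h)
      · exact absurd h1.2 (not_lt.2 h)
    have hR : (B'.filter fun t => X.time p ≤ X.time (q t)).card ≤ 1 := by
      refine card_le_one.2 fun t ht t' ht' => ?_
      obtain ⟨ht, h1⟩ := mem_filter.1 ht
      obtain ⟨ht', h2⟩ := mem_filter.1 ht'
      rcases le_total (X.time (q t)) (X.time (q t')) with h | h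
      · exact hnest t ht t' ht' (Set.mem_uIcc.2 (.inl ⟨h1, h⟩))
      · exact (hnest t' ht' t ht (Set.mem_uIcc.2 (.inl ⟨h2, h⟩))).symm
    have hL : (B'.filter fun t => ¬ X.time p ≤ X.time (q t)).card ≤ 1 := by
      refine card_le_one.2 fun t ht t' ht' => ?_
      obtain ⟨ht, h1⟩ := mem_filter.1 ht
      obtain ⟨ht', h2⟩ := mem_filter.1 ht'
      rcases le_total (X.time (q t)) (X.time (q t')) with h | h
      · exact (hnest t' ht' t ht (Set.mem_uIcc.2 (.inr ⟨h, by omega⟩))).symm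
      · exact hnest t ht t' ht' (Set.mem_uIcc.2 (.inr ⟨h, by omega⟩))
    have h1 := card_filter_add_card_filter_not (s := B') (fun t => X.time p ≤ X.time (q t))
    have h2 := pred_card_le_card_erase (s := B) (a := l)
    have h3 := pred_card_le_card_erase (s := B.erase l) (a := u)
    rw [← hB'] at h3
    omega

/-- The incidence bound obtained by averaging over samples of `r` curves. -/
theorem sum_card_incident_le (X : CurveSystem τ π d β) {r : ℕ} (hr : r < X.curves.card) {μ : ℝ}
    (hμ : 0 < μ) :
    ∑ t ∈ X.curves, ((X.points.filter fun p => X.gap p t = 0).card : ℝ) ≤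
      X.curves.card + 4 * d * r * X.curves.card +
        5 * μ * X.points.card * X.curves.card / (r + 1) +
        β * X.points.card * X.curves.card / (μ * (X.curves.card - r)) := by
  set w : τ → ℝ := fun t => ((X.points.filter fun p => X.gap p t = 0).card : ℝ) with hw
  set G : Finset τ → τ → ℝ := fun R t =>
    (((X.freePoints R t).image (X.cell (X.hat R))).card : ℝ) +
      μ * ((X.points.filter fun p => X.Free (X.hat R) p ∧
        X.cell (X.hat R) p ∈ (X.freePoints R t).image (X.cell (X.hat R))).card : ℝ) with hG
  have hsample : ∀ R ∈ X.curves.powersetCard r, ∑ t ∈ X.curves \ R, w t ≤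
      ∑ t ∈ X.curves \ R, G R t +
        ((X.curves.card - r) * (d * r) + β * X.points.card / μ) := by
    intro R hR
    obtain ⟨hRT, hRc⟩ := mem_powersetCard.1 hR
    have hwt : ∀ t ∈ X.curves \ R, w t ≤ ((X.freePoints R t).card : ℝ) + d * r := by
      intro t ht
      obtain ⟨htT, htR⟩ := mem_sdiff.1 ht
      have hsub : (X.points.filter fun p => X.gap p t = 0) ⊆ X.freePoints R t ∪
          R.biUnion fun s => X.points.filter fun p => X.gap p s = 0 ∧ X.gap p t = 0 := by
        intro p hp
        obtain ⟨hpP, hpt⟩ := mem_filter.1 hp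
        by_cases hf : X.Free (X.hat R) p
        · exact mem_union_left _ (mem_filter.2 ⟨hpP, hf, hpt⟩)
        · simp only [Free, not_forall, not_not] at hf
          obtain ⟨s, hs, hps⟩ := hf
          refine mem_union_right _ (mem_biUnion.2 ⟨s, ?_, mem_filter.2 ⟨hpP, hps, hpt⟩⟩)
          rcases mem_hat.1 hs with hs | rfl | rfl
          exacts [hs, absurd hps (X.gap_bot p hpP).ne, absurd hps (X.gap_top p hpP).ne']
      have hbi : (R.biUnion fun s => X.points.filter fun p =>
          X.gap p s = 0 ∧ X.gap p t = 0).card ≤ R.card * d := by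
        refine card_biUnion_le_card_mul _ _ _ fun s hs => ?_
        rw [← Set.ncard_coe_finset]
        refine le_trans (le_of_eq (congrArg Set.ncard ?_))
          (X.card_meet_le s (hRT hs) t htT fun h => htR (h ▸ hs))
        ext p
        rw [mem_coe, mem_filter]
        rfl
      have := (card_le_card hsub).trans ((card_union_le _ _).trans (Nat.add_le_add_left hbi _))
      rw [hRc, mul_comm] at this
      simp only [hw]
      exact_mod_cast this
    have hcells := sum_card_le_of_cells (X.curves \ R)
      (X.points.filter (X.Free (X.hat R))) (X.freePoints R)
      (fun t _ p hp => by
        simp only [freePoints, mem_filter] at hp ⊢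
        exact ⟨hp.1, hp.2.1⟩) β
      (fun p hp q hq hpq => by
        rw [← Set.ncard_coe_finset]
        refine le_trans (Set.ncard_le_ncard ?_ (X.curves.finite_toSet.subset fun t ht => ht.1))
          (X.card_common_le p (mem_filter.1 hp).1 q (mem_filter.1 hq).1 hpq)
        intro t ht
        simp only [freePoints, coe_filter, mem_filter, mem_sdiff, Set.mem_ofPred_eq] at ht ⊢
        exact ⟨ht.1.1, ht.2.1.2.2, ht.2.2.2.2⟩)
      (X.cell (X.hat R)) hμ
    have hswap : ∑ p ∈ X.points.filter (X.Free (X.hat R)),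
        (((X.curves \ R).filter fun t =>
          X.cell (X.hat R) p ∈ (X.freePoints R t).image (X.cell (X.hat R))).card : ℝ) =
        ∑ t ∈ X.curves \ R, ((X.points.filter fun p => X.Free (X.hat R) p ∧
          X.cell (X.hat R) p ∈ (X.freePoints R t).image (X.cell (X.hat R))).card : ℝ) := by
      have h := sum_card_bipartiteAbove_eq_sum_card_bipartiteBelow (s := X.curves \ R)
        (t := X.points.filter (X.Free (X.hat R)))
        (fun t p => X.cell (X.hat R) p ∈ (X.freePoints R t).image (X.cell (X.hat R)))
      simp only [bipartiteAbove, bipartiteBelow, filter_filter] at h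
      exact_mod_cast h.symm
    rw [hswap] at hcells
    have hA : (β : ℝ) * (X.points.filter (X.Free (X.hat R))).card / μ ≤
        β * X.points.card / μ := by
      gcongr
      exact filter_subset _ _
    have hcard : ((X.curves \ R).card : ℝ) = X.curves.card - r := by
      rw [card_sdiff_of_subset hRT, hRc, Nat.cast_sub hr.le]
    have hsum := sum_le_sum hwt
    rw [sum_add_distrib, sum_const, nsmul_eq_mul, hcard] at hsum
    simp only [hG, sum_add_distrib, ← mul_sum]
    linarith
  have hbackward : ∀ S ∈ X.curves.powersetCard (r + 1), ∑ t ∈ S, G (S.erase t) t ≤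
      (r + 1) * (1 + 3 * d * r) + 5 * μ * X.points.card := by
    intro S hS
    obtain ⟨hST, hSc⟩ := mem_powersetCard.1 hS
    simp only [hG, sum_add_distrib, ← mul_sum]
    have h1 : (∑ t ∈ S, (((X.freePoints (S.erase t) t).image
        (X.cell (X.hat (S.erase t)))).card : ℝ)) ≤ (r + 1) * (1 + 3 * d * r) := by
      have h := (sum_le_sum fun t ht => card_image_cell_le hST ht).trans
        (le_of_eq sum_add_distrib)
      have h' := sum_card_breaks_le hST
      rw [sum_const, smul_eq_mul, mul_one, hSc] at h
      have h3 : 3 * (d * ((r + 1) * (r + 1) - (r + 1))) + (r + 1) =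
          (r + 1) * (1 + 3 * d * r) := by
        have : (r + 1) * (r + 1) - (r + 1) = (r + 1) * r := by
          rw [Nat.mul_succ, Nat.add_sub_cancel]
        rw [this]; ring
      rw [hSc] at h'
      have h4 := h.trans ((Nat.add_le_add_right h' _).trans h3.le)
      exact_mod_cast h4
    have h2 : (∑ t ∈ S, ((X.points.filter fun p => X.Free (X.hat (S.erase t)) p ∧
        X.cell (X.hat (S.erase t)) p ∈ (X.freePoints (S.erase t) t).image
          (X.cell (X.hat (S.erase t)))).card : ℝ)) ≤ 5 * X.points.card := by
      have h := sum_card_bipartiteAbove_eq_sum_card_bipartiteBelow (s := S) (t := X.points)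
        (fun t p => X.Free (X.hat (S.erase t)) p ∧
          X.cell (X.hat (S.erase t)) p ∈ (X.freePoints (S.erase t) t).image
            (X.cell (X.hat (S.erase t))))
      have h' := sum_le_sum fun p (hp : p ∈ X.points) => card_cell_mem_image_le hST hp
      simp only [bipartiteAbove, bipartiteBelow] at h
      rw [← h, sum_const, smul_eq_mul, mul_comm] at h'
      exact_mod_cast h'
    nlinarith [mul_le_mul_of_nonneg_left h2 hμ.le]
  have htotal := sum_le_sum hsample
  rw [sum_add_distrib, sum_powersetCard_sdiff_comm _ _ G, sum_const, card_powersetCard,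
    nsmul_eq_mul] at htotal
  have hback := sum_le_sum hbackward
  rw [sum_const, card_powersetCard, nsmul_eq_mul] at hback
  have hW := sum_powersetCard_sum_sdiff X.curves hr.le w
  set n : ℝ := (X.curves.card : ℝ) with hn
  set m : ℝ := (X.points.card : ℝ) with hm
  have hD : 0 < n - r := by
    have : (r : ℝ) < n := Nat.cast_lt.2 hr
    linarith
  have hn0 : 0 ≤ n := by positivity
  have hchoose : ((X.curves.card.choose (r + 1) : ℕ) : ℝ) =
      (X.curves.card.choose r : ℝ) * (n - r) / (r + 1) := by
    rw [eq_div_iff (by positivity), hn, ← Nat.cast_sub hr.le]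
    exact_mod_cast Nat.choose_succ_right_eq X.curves.card r
  have hB : (0 : ℝ) < (X.curves.card.choose r : ℝ) := by exact_mod_cast Nat.choose_pos hr.le
  rw [hchoose] at hback
  set B : ℝ := (X.curves.card.choose r : ℝ)
  have hle := mul_le_mul_of_nonneg_left (htotal.trans (add_le_add_left hback _)) hn0
  rw [hW] at hle
  refine le_of_mul_le_mul_left (hle.trans (le_of_eq ?_)) (mul_pos hB hD)
  field_simp
  ring

/-- Székely's incidence bound, with exponent `1 / 3` for the intersection number `d`. -/
theorem sum_card_incident_le_rpow (X : CurveSystem τ π d β) (hd : 1 ≤ d) (hβ : 1 ≤ β) :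
    ∑ t ∈ X.curves, ((X.points.filter fun p => X.gap p t = 0).card : ℝ) ≤
      14 * ((d : ℝ) ^ ((1 : ℝ) / 3) * (β : ℝ) ^ ((1 : ℝ) / 3) *
        (X.points.card : ℝ) ^ ((2 : ℝ) / 3) * (X.curves.card : ℝ) ^ ((2 : ℝ) / 3) +
        X.curves.card + β * X.points.card) := by
  rcases Nat.eq_zero_or_pos X.curves.card with hn0 | hn0
  · rw [card_eq_zero.1 hn0, sum_empty]
    positivity
  rcases Nat.eq_zero_or_pos X.points.card with hm0 | hm0
  · rw [card_eq_zero.1 hm0]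
    simp only [filter_empty, card_empty, Nat.cast_zero, sum_const_zero]
    positivity
  have hmain := @sum_card_incident_le τ π d β X
  set n : ℝ := (X.curves.card : ℝ) with hn
  set m : ℝ := (X.points.card : ℝ) with hm
  have hnpos : 0 < n := Nat.cast_pos.2 hn0
  have hmpos : 0 < m := Nat.cast_pos.2 hm0
  have hd1 : (1 : ℝ) ≤ d := by exact_mod_cast hd
  have hβ1 : (1 : ℝ) ≤ β := by exact_mod_cast hβ
  have hdpos : (0 : ℝ) < d := by linarith
  have hβpos : (0 : ℝ) < β := by linarith
  set Q : ℝ := (d : ℝ) ^ ((1 : ℝ) / 3) * (β : ℝ) ^ ((1 : ℝ) / 3) * m ^ ((2 : ℝ) / 3) *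
    n ^ ((2 : ℝ) / 3) with hQ
  have hQpos : 0 < Q := by positivity
  have hQ3 : Q ^ 3 = d * β * m ^ 2 * n ^ 2 := by
    have h1 : ∀ y : ℝ, 0 ≤ y → (y ^ ((1 : ℝ) / 3)) ^ 3 = y := fun y hy => by
      rw [← Real.rpow_natCast, ← Real.rpow_mul hy]; norm_num
    have h2 : ∀ y : ℝ, 0 ≤ y → (y ^ ((2 : ℝ) / 3)) ^ 3 = y ^ 2 := fun y hy => by
      rw [← Real.rpow_natCast, ← Real.rpow_mul hy]; norm_num
    rw [hQ, mul_pow, mul_pow, mul_pow, h1 _ hdpos.le, h1 _ hβpos.le, h2 _ hmpos.le,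
      h2 _ hnpos.le]
  set r₀ : ℝ := min (Q / (d * n)) (n / 2) with hr₀
  have hr₀pos : 0 ≤ r₀ := by positivity
  set r : ℕ := ⌊r₀⌋₊ with hr
  have hrle : (r : ℝ) ≤ r₀ := Nat.floor_le hr₀pos
  have hrlt : r₀ < r + 1 := Nat.lt_floor_add_one r₀
  have hrQ : (r : ℝ) ≤ Q / (d * n) := hrle.trans (min_le_left _ _)
  have hrn : (r : ℝ) ≤ n / 2 := hrle.trans (min_le_right _ _)
  have hr1 : (0 : ℝ) < r + 1 := by positivity
  have hrcard : r < X.curves.card := by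
    have : (r : ℝ) < n := by linarith
    exact Nat.cast_lt.1 this
  set μ : ℝ := √(β * (r + 1) / n) with hμ
  have hμpos : 0 < μ := Real.sqrt_pos.2 (by positivity)
  have hμ2 : μ ^ 2 * n = β * (r + 1) := by
    rw [hμ, Real.sq_sqrt (by positivity)]
    field_simp
  set Y : ℝ := β * m / μ with hY
  have hYpos : 0 < Y := by positivity
  have hY2 : Y ^ 2 * (r + 1) = β * m ^ 2 * n := by
    have h : Y * μ = β * m := by rw [hY]; field_simp
    have h2 : (Y * μ) ^ 2 = (β * m) ^ 2 := by rw [h]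
    have h3 : β * (Y ^ 2 * (r + 1)) = β * (β * m ^ 2 * n) := by
      calc β * (Y ^ 2 * (r + 1)) = Y ^ 2 * (μ ^ 2 * n) := by rw [hμ2]; ring
        _ = (Y * μ) ^ 2 * n := by ring
        _ = β * (β * m ^ 2 * n) := by rw [h2]; ring
    exact mul_left_cancel₀ hβpos.ne' h3
  have hYle : Y ≤ Q + 2 * (β * m) := by
    have hbm : 0 < β * m := by positivity
    rcases le_total (Q / (d * n)) (n / 2) with h | h
    · have h1 : Q / (d * n) ≤ r + 1 := by rw [hr₀, min_eq_left h] at hrlt; exact hrlt.le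
      have h2 : Y ^ 2 * (Q / (d * n)) ≤ β * m ^ 2 * n :=
        hY2 ▸ mul_le_mul_of_nonneg_left h1 (sq_nonneg Y)
      have h3 : Y ^ 2 * Q ≤ Q ^ 2 * Q := by
        rw [← mul_div_assoc, div_le_iff₀ (by positivity)] at h2
        calc Y ^ 2 * Q ≤ β * m ^ 2 * n * (d * n) := h2
          _ = Q ^ 3 := by rw [hQ3]; ring
          _ = Q ^ 2 * Q := by ring
      have h4 := le_of_mul_le_mul_right h3 hQpos
      have h5 := (pow_le_pow_iff_left₀ hYpos.le hQpos.le two_ne_zero).1 h4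
      linarith
    · have h1 : n / 2 ≤ r + 1 := by rw [hr₀, min_eq_right h] at hrlt; exact hrlt.le
      have h2 : Y ^ 2 * (n / 2) ≤ β * m ^ 2 * n :=
        hY2 ▸ mul_le_mul_of_nonneg_left h1 (sq_nonneg Y)
      have h3 : Y ^ 2 * n ≤ (2 * β * m ^ 2) * n := by linarith
      have h4 := le_of_mul_le_mul_right h3 hnpos
      have h5 : Y ^ 2 ≤ (2 * (β * m)) ^ 2 := by
        nlinarith [mul_nonneg (mul_nonneg hβpos.le (sub_nonneg.2 hβ1)) (sq_nonneg m),
          mul_nonneg hβpos.le (sq_nonneg m)]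
      have h6 := (pow_le_pow_iff_left₀ hYpos.le (by positivity) two_ne_zero).1 h5
      linarith
  have hterm1 : 4 * d * r * n ≤ 4 * Q := by
    rw [le_div_iff₀ (by positivity)] at hrQ
    linarith
  have hterm2 : 5 * μ * m * n / (r + 1) = 5 * Y := by
    rw [hY, mul_div_assoc', div_eq_div_iff hr1.ne' hμpos.ne']
    linear_combination 5 * m * hμ2
  have hterm3 : β * m * n / (μ * (n - r)) ≤ 2 * Y := by
    rw [hY, mul_div_assoc', div_le_div_iff₀ (mul_pos hμpos (by linarith)) hμpos]
    have : 0 ≤ β * m * μ * (n - 2 * r) := mul_nonneg (by positivity) (by linarith)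
    linarith
  have hbm : 0 < β * m := by positivity
  have := hmain hrcard hμpos
  linarith

end CurveSystem

/-- Every finite set of reals can be listed increasingly. -/
lemma exists_increasing_enumeration (A : Finset ℝ) :
    ∃ (x : ℕ → ℝ) (i : ℝ → ℕ), (∀ j < A.card, x j ∈ A) ∧ (∀ a ∈ A, i a < A.card ∧ x (i a) = a) ∧
      ∀ j k, j < k → k < A.card → x j < x k := by
  classical
  let e := A.orderIsoOfFin rfl
  refine ⟨fun j => if h : j < A.card then (e ⟨j, h⟩ : ℝ) else 0,
    fun a => if h : a ∈ A then (e.symm ⟨a, h⟩ : ℕ) else 0, fun j hj => ?_, fun a ha => ?_,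
    fun j k hjk hk => ?_⟩
  · simp only [dif_pos hj]
    exact (e ⟨j, hj⟩).2
  · simp [dif_pos ha]
  · simp only [dif_pos hk, dif_pos (hjk.trans hk)]
    exact e.strictMono (show (⟨j, _⟩ : Fin A.card) < ⟨k, hk⟩ from hjk)

open Filter Topology in
/-- A small shift to the right separates all polynomials of a finite family while keeping the
strict inequalities between their values. -/
lemma exists_shift (A : Finset ℝ) (T : Finset (Polynomial ℝ)) :
    ∃ ε : ℝ, ∀ a ∈ A, ∀ s ∈ T, ∀ t ∈ T, (s.eval a < t.eval a → s.eval (a + ε) < t.eval (a + ε)) ∧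
      (s ≠ t → s.eval (a + ε) ≠ t.eval (a + ε)) := by
  have h : ∀ᶠ ε : ℝ in 𝓝[≠] 0, ∀ a ∈ A, ∀ s ∈ T, ∀ t ∈ T,
      (s.eval a < t.eval a → s.eval (a + ε) < t.eval (a + ε)) ∧
      (s ≠ t → s.eval (a + ε) ≠ t.eval (a + ε)) := by
    refine (eventually_all_finset A).2 fun a _ => (eventually_all_finset T).2 fun s _ =>
      (eventually_all_finset T).2 fun t _ => Eventually.and ?_ ?_
    · by_cases hst : s.eval a < t.eval a
      · have hs : ContinuousAt (fun ε : ℝ => s.eval (a + ε)) 0 := by fun_prop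
        have ht : ContinuousAt (fun ε : ℝ => t.eval (a + ε)) 0 := by fun_prop
        have := hs.eventually_lt ht (by simpa using hst)
        exact (this.filter_mono nhdsWithin_le_nhds).mono fun ε h _ => h
      · exact Eventually.of_forall fun ε h => absurd h hst
    · by_cases hst : s = t
      · exact Eventually.of_forall fun ε h => absurd hst h
      · have hfin : {ε : ℝ | s.eval (a + ε) = t.eval (a + ε)}.Finite := by
          refine ((s - t).rootSet_finite ℝ).preimage (f := fun ε => a + ε)
            (add_right_injective a).injOn |>.subset fun ε hε => ?_
          simp only [Set.mem_preimage, Polynomial.mem_rootSet, Polynomial.coe_aeval_eq_eval]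
          exact ⟨sub_ne_zero.2 hst, by simpa [sub_eq_zero] using hε⟩
        have hmem := nhdsNE_le_cofinite (0 : ℝ) hfin.compl_mem_cofinite
        filter_upwards [hmem] with ε h _ using h
  exact h.exists

/-- Two distinct polynomials of degree at most `d` agree in at most `d` places. -/
lemma ncard_le_of_injOn_eval_eq {ι : Type*} {d : ℕ} {s t : Polynomial ℝ} (hs : s.natDegree ≤ d)
    (ht : t.natDegree ≤ d) (hst : s ≠ t) (U : Set ι) (x : ι → ℝ) (hx : Set.InjOn x U)
    (h : ∀ i ∈ U, s.eval (x i) = t.eval (x i)) : U.ncard ≤ d := by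
  classical
  calc U.ncard ≤ ((s - t).roots.toFinset : Set ℝ).ncard := by
        refine Set.ncard_le_ncard_of_injOn x (fun i hi => ?_) hx (Finset.finite_toSet _)
        simp [sub_ne_zero.2 hst, h i hi]
    _ ≤ d := by
        rw [Set.ncard_coe_finset]
        exact (Multiset.toFinset_card_le _).trans ((Polynomial.card_roots' _).trans
          ((Polynomial.natDegree_sub_le s t).trans (max_le hs ht)))

/-- A family of polynomials of bounded degree and a set of points form a `CurveSystem`. -/
lemma exists_curveSystem {d β : ℕ} (P : Finset (ℝ × ℝ)) (T : Finset (Polynomial ℝ))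
    (hT : ∀ t ∈ T, t.natDegree ≤ d)
    (hβ : ∀ p ∈ P, ∀ q ∈ P, p ≠ q →
      (T.filter (fun t => t.eval p.1 = p.2 ∧ t.eval q.1 = q.2)).card ≤ β) :
    ∃ X : CurveSystem (Polynomial ℝ) (ℝ × ℝ) d β, X.curves = T ∧ X.points = P ∧
      ∀ p t, X.gap p t = t.eval p.1 - p.2 := by
  classical
  set A := P.image Prod.fst with hA
  obtain ⟨x, i, hxA, hi, hx⟩ := exists_increasing_enumeration A
  obtain ⟨M, hMT, hMP, hM⟩ : ∃ M : ℝ, (∀ a ∈ A, ∀ t ∈ T, |t.eval a| < M) ∧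
      (∀ p ∈ P, |p.2| < M) ∧ 0 < M := by
    have hPnn : 0 ≤ ∑ p ∈ P, |p.2| := sum_nonneg fun _ _ => abs_nonneg _
    have hTnn : ∀ a ∈ A, 0 ≤ ∑ t ∈ T, |t.eval a| := fun _ _ => sum_nonneg fun _ _ => abs_nonneg _
    have hAnn := sum_nonneg hTnn
    refine ⟨1 + ∑ a ∈ A, ∑ t ∈ T, |t.eval a| + ∑ p ∈ P, |p.2|, fun a ha t ht => ?_,
      fun p hp => ?_, by linarith⟩
    · have h1 := single_le_sum hTnn ha
      have h2 := single_le_sum (f := fun t : Polynomial ℝ => |t.eval a|)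
        (fun _ _ => abs_nonneg _) ht
      linarith
    · have h1 := single_le_sum (f := fun p : ℝ × ℝ => |p.2|) (fun _ _ => abs_nonneg _) hp
      linarith
  obtain ⟨ε, hε⟩ := exists_shift A
    (insert (Polynomial.C (-M)) (insert (Polynomial.C M) T))
  have hmemA : ∀ p ∈ P, p.1 ∈ A := fun p hp => mem_image_of_mem _ hp
  have hshift : ∀ a ∈ A, ∀ s t : Polynomial ℝ,
      (s ∈ T ∨ s = Polynomial.C (-M) ∨ s = Polynomial.C M) →
      (t ∈ T ∨ t = Polynomial.C (-M) ∨ t = Polynomial.C M) → s.eval a < t.eval a →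
      s.eval (a + ε) < t.eval (a + ε) := by
    intro a ha s t hs ht
    refine (hε a ha s ?_ t ?_).1 <;> simp only [mem_insert] <;> tauto
  refine ⟨{
    curves := T
    points := P
    steps := A.card
    height := fun j t => t.eval (x j + ε)
    time := fun p => i p.1
    gap := fun p t => t.eval p.1 - p.2
    bot := Polynomial.C (-M)
    top := Polynomial.C M
    time_lt := fun p hp => (hi _ (hmemA p hp)).1
    height_injOn := ?_
    bot_lt := ?_
    lt_top := ?_
    bot_lt_top := ?_
    gap_bot := ?_
    gap_top := ?_
    height_lt_of_gap_lt := ?_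
    card_flips_le := ?_
    card_meet_le := ?_
    card_common_le := ?_ }, rfl, rfl, fun _ _ => rfl⟩
  · intro j hj s hs t ht hst
    by_contra hne
    exact (hε _ (hxA j hj) s (by simp [mem_coe.1 hs]) t (by simp [mem_coe.1 ht])).2 hne hst
  · intro j hj t ht
    refine hshift _ (hxA j hj) _ _ (.inr (.inl rfl)) (.inl ht) ?_
    simpa using (abs_lt.1 (hMT _ (hxA j hj) t ht)).1
  · intro j hj t ht
    refine hshift _ (hxA j hj) _ _ (.inl ht) (.inr (.inr rfl)) ?_
    simpa using (abs_lt.1 (hMT _ (hxA j hj) t ht)).2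
  · intro j hj
    simp only [Polynomial.eval_C]
    linarith
  · intro p hp
    simp only [Polynomial.eval_C]
    linarith [(abs_lt.1 (hMP p hp)).1]
  · intro p hp
    simp only [Polynomial.eval_C]
    linarith [(abs_lt.1 (hMP p hp)).2]
  · intro p hp s t hs ht hst
    rw [(hi _ (hmemA p hp)).2]
    exact hshift _ (hmemA p hp) s t hs ht (by linarith)
  · intro s hs t ht hst
    have hroot : ∀ j ∈ {j : ℕ | j + 1 < A.card ∧
        ((s.eval (x j + ε) < t.eval (x j + ε) ∧ t.eval (x (j + 1) + ε) < s.eval (x (j + 1) + ε)) ∨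
        (t.eval (x j + ε) < s.eval (x j + ε) ∧ s.eval (x (j + 1) + ε) < t.eval (x (j + 1) + ε)))},
        ∃ y ∈ Set.Ioo (x j + ε) (x (j + 1) + ε), s.eval y = t.eval y := by
      rintro j ⟨hj, hflip⟩
      have hlt := hx j (j + 1) (Nat.lt_succ_self j) hj
      have hcont : ContinuousOn (fun y => s.eval y - t.eval y)
          (Set.Icc (x j + ε) (x (j + 1) + ε)) := by fun_prop
      rcases hflip with h | h
      · obtain ⟨y, hy, hy0⟩ := intermediate_value_Ioo (by linarith) hcont
          (show (0 : ℝ) ∈ _ from ⟨by linarith, by linarith⟩)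
        exact ⟨y, hy, sub_eq_zero.1 hy0⟩
      · obtain ⟨y, hy, hy0⟩ := intermediate_value_Ioo' (by linarith) hcont
          (show (0 : ℝ) ∈ _ from ⟨by linarith, by linarith⟩)
        exact ⟨y, hy, sub_eq_zero.1 hy0⟩
    choose! y hy hyeq using hroot
    refine ncard_le_of_injOn_eval_eq (hT s hs) (hT t ht) hst _ y ?_ hyeq
    have hmono : ∀ j k, j < k → k < A.card → x (j + 1) ≤ x k := by
      intro j k hjk hk
      rcases Nat.lt_or_eq_of_le (Nat.succ_le_of_lt hjk) with h | h
      · exact (hx _ _ h hk).le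
      · exact le_of_eq (congrArg x h)
    intro j hj k hk hjk
    by_contra hne
    rcases lt_or_gt_of_ne hne with h | h
    · have := hmono j k h (by have := hk.1; omega)
      linarith [(hy j hj).2, (hy k hk).1]
    · have := hmono k j h (by have := hj.1; omega)
      linarith [(hy k hk).2, (hy j hj).1]
  · intro s hs t ht hst
    refine ncard_le_of_injOn_eval_eq (hT s hs) (hT t ht) hst _ Prod.fst ?_ ?_
    · rintro p ⟨-, hp, -⟩ q ⟨-, hq, -⟩ hpq
      refine Prod.ext hpq ?_
      rw [← sub_eq_zero.1 hp, ← sub_eq_zero.1 hq, hpq]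
    · rintro p ⟨-, hp, hp'⟩
      linarith
  · intro p hp q hq hpq
    refine le_trans (le_of_eq ?_) (hβ p hp q hq hpq)
    rw [← Set.ncard_coe_finset]
    congr 1
    ext t
    simp [sub_eq_zero]

/-- Székely's incidence theorem for graphs of polynomials: if any two distinct points
of `P` lie simultaneously on at most `β` of the graphs of the distinct polynomials in
`T` (each of degree `≤ d`), then
`I(P,T) ≤ C·(d^{1/2} β^{1/3} |P|^{2/3} |T|^{2/3} + |T| + β|P|)`. -/
theorem szekely_incidence_polynomial_graphs :
    ∃ C : ℝ, 0 < C ∧ ∀ (d β : ℕ), 1 ≤ d → 1 ≤ β →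
      ∀ (P : Finset (ℝ × ℝ)) (T : Finset (Polynomial ℝ)),
        (∀ t ∈ T, t.natDegree ≤ d) →
        (∀ p ∈ P, ∀ q ∈ P, p ≠ q →
          (T.filter (fun t => t.eval p.1 = p.2 ∧ t.eval q.1 = q.2)).card ≤ β) →
        (((P ×ˢ T).filter (fun pt => pt.2.eval pt.1.1 = pt.1.2)).card : ℝ) ≤
          C * ((d : ℝ) ^ ((1 : ℝ) / 2) * (β : ℝ) ^ ((1 : ℝ) / 3) *
                (P.card : ℝ) ^ ((2 : ℝ) / 3) * (T.card : ℝ) ^ ((2 : ℝ) / 3) +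
              (T.card : ℝ) + (β : ℝ) * (P.card : ℝ)) := by
  refine ⟨14, by norm_num, fun d β hd hβ P T hT hcommon => ?_⟩
  obtain ⟨X, hXT, hXP, hgap⟩ := exists_curveSystem P T hT hcommon
  have h := X.sum_card_incident_le_rpow hd hβ
  rw [hXT, hXP] at h
  have hcard : (((P ×ˢ T).filter (fun pt => pt.2.eval pt.1.1 = pt.1.2)).card : ℝ) =
      ∑ t ∈ T, ((P.filter fun p => X.gap p t = 0).card : ℝ) := by
    simp only [hgap, sub_eq_zero, card_filter, sum_product_right, Nat.cast_sum]
  have hpow : (d : ℝ) ^ ((1 : ℝ) / 3) ≤ (d : ℝ) ^ ((1 : ℝ) / 2) :=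
    Real.rpow_le_rpow_of_exponent_le (by exact_mod_cast hd) (by norm_num)
  rw [hcard]
  refine le_trans (le_trans (le_of_eq ?_) h) ?_
  · congr!
  · gcongr
end

section
/- Let f(x,y) ∈ ℝ[x,y] have total degree k ≥ 2 with deg_x(f) ≥ deg_y(f). Let (x₀, y₀) and (x₀′, y₀′) be two distinct points of ℝ² such that both f(x,y) − y₀ and f(x,y) − y₀′ are irreducible in ℂ[x,y]. Then the number of pairs (a,b) ∈ ℝ² satisfying simultaneously f(x₀ − a, b) = y₀ and f(x₀′ − a, b) = y₀′ is at most k². -/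
theorem MvPolynomial.two_mul_finrank_restrictTotalDegree_fin_two (K : Type*) [Field K] (d : ℕ) :
    2 * Module.finrank K (restrictTotalDegree (Fin 2) K d) = (d + 1) * (d + 2) := by
  have hcard : Nat.card {n : Fin 2 →₀ ℕ | (n.sum fun _ e => e) ≤ d} =
      ∑ i ∈ Finset.range (d + 1), (i + 1) := by
    have key : Set.ncard {n : Fin 2 →₀ ℕ | (n.sum fun _ e => e) ≤ d} =
        Set.ncard (((Finset.range (d + 1)).sigma fun i => Finset.HasAntidiagonal.antidiagonal i :
          Finset (Σ _ : ℕ, ℕ × ℕ)) : Set (Σ _ : ℕ, ℕ × ℕ)) := by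
      refine Set.ncard_congr (fun n _ => ⟨n 0 + n 1, n 0, n 1⟩) ?_ ?_ ?_
      · intro n hn
        rw [Set.mem_ofPred_eq, Finsupp.sum_fintype _ _ (fun _ => rfl), Fin.sum_univ_two] at hn
        simp only [Finset.coe_sigma, Set.mem_sigma_iff, Finset.mem_coe, Finset.mem_range,
          Finset.HasAntidiagonal.mem_antidiagonal, and_true]
        omega
      · intro n n' _ _ h
        simp only [Sigma.mk.injEq, heq_eq_eq, Prod.mk.injEq] at h
        ext i
        fin_cases i
        · exact h.2.1
        · exact h.2.2
      · rintro ⟨i, a, b⟩ h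
        simp only [Finset.coe_sigma, Set.mem_sigma_iff, Finset.mem_coe, Finset.mem_range,
          Finset.HasAntidiagonal.mem_antidiagonal] at h
        obtain ⟨h1, rfl⟩ := h
        refine ⟨Finsupp.equivFunOnFinite.symm ![a, b], ?_, ?_⟩
        · rw [Set.mem_ofPred_eq, Finsupp.sum_fintype _ _ (fun _ => rfl), Fin.sum_univ_two]
          simp
          omega
        · simp
    rw [Nat.card_coe_set_eq, key, Set.ncard_coe_finset, Finset.card_sigma]
    simp
  have hfin : Module.finrank K (restrictTotalDegree (Fin 2) K d) =
      ∑ i ∈ Finset.range (d + 1), (i + 1) := by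
    rw [← hcard]
    exact Module.finrank_eq_nat_card_basis (basisRestrictSupport K _)
  rw [hfin]
  clear hcard hfin
  induction d with
  | zero => simp
  | succ d ih => rw [Finset.sum_range_succ, mul_add, ih]; ring

theorem MvPolynomial.exists_eval_eq_one_and_eval_eq_zero {σ K : Type*} [Field K]
    (S : Finset (σ → K)) (p : σ → K) :
    ∃ P : MvPolynomial σ K, eval p P = 1 ∧ ∀ q ∈ S, q ≠ p → eval q P = 0 := by
  classical
  have hsep : ∀ q : σ → K, ∃ L : MvPolynomial σ K, eval p L = 1 ∧ (q ≠ p → eval q L = 0) := by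
    intro q
    by_cases hq : q = p
    · exact ⟨1, by simp, fun h => absurd hq h⟩
    · obtain ⟨i, hi⟩ := Function.ne_iff.mp hq
      have hi' : p i - q i ≠ 0 := sub_ne_zero.mpr (Ne.symm hi)
      exact ⟨C (p i - q i)⁻¹ * (X i - C (q i)), by simp [hi'], by simp⟩
  choose L hL1 hL0 using hsep
  refine ⟨∏ q ∈ S, L q, by simp [map_prod, hL1], fun q hq hqp => ?_⟩
  rw [map_prod]
  exact Finset.prod_eq_zero hq (hL0 q hqp)

/-- **Bézout's bound** for an irreducible affine plane curve and a curve not containing it. -/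
theorem MvPolynomial.card_common_zeros_le_of_irreducible {K : Type*} [Field K]
    {g h : MvPolynomial (Fin 2) K} {m n : ℕ} (hg : Irreducible g) (hm : g.totalDegree = m)
    (hn : h.totalDegree ≤ n) (hgh : ¬ g ∣ h) (S : Finset (Fin 2 → K))
    (hS : ∀ p ∈ S, eval p g = 0 ∧ eval p h = 0) : S.card ≤ m * n := by
  classical
  choose P hP1 hP0 using exists_eval_eq_one_and_eval_eq_zero S
  set e := ∑ p ∈ S, (P p).totalDegree with he
  let V := fun d => restrictTotalDegree (Fin 2) K d
  have hV (d : ℕ) (p) : p ∈ V d ↔ p.totalDegree ≤ d := mem_restrictTotalDegree _ _ _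
  let ψ : V (e + m + n) →ₗ[K] (S → K) :=
    (LinearMap.pi fun p : S => (aeval (R := K) p.1).toLinearMap).domRestrict (V (e + m + n))
  have hψ (v) (p : S) : ψ v p = eval p.1 v.1 := by simp [ψ, aeval_eq_eval]
  have hψtop : LinearMap.range ψ = ⊤ := by
    rw [eq_top_iff]
    intro c _
    refine ⟨⟨∑ p : S, c p • P p, ?_⟩, ?_⟩
    · refine Submodule.sum_mem _ fun p _ => Submodule.smul_mem _ _ ?_
      rw [hV]
      have := Finset.single_le_sum (f := fun p => (P p).totalDegree) (fun _ _ => Nat.zero_le _) p.2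
      omega
    · ext p
      rw [hψ, map_sum, Finset.sum_eq_single p]
      · simp [hP1]
      · intro q _ hqp
        rw [smul_eval, hP0 q p p.2 (fun h => hqp (Subtype.ext h.symm)), mul_zero]
      · simp
  let φ : (V (e + n) × V (e + m)) →ₗ[K] MvPolynomial (Fin 2) K :=
    ((LinearMap.mulLeft K g).domRestrict (V (e + n))).coprod
      ((LinearMap.mulLeft K h).domRestrict (V (e + m)))
  have hφ (x) : φ x = g * x.1.1 + h * x.2.1 := by simp [φ]
  have hrange : LinearMap.range φ ≤ (LinearMap.ker ψ).map (V (e + m + n)).subtype := by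
    rintro _ ⟨⟨⟨u, hu⟩, ⟨v, hv⟩⟩, rfl⟩
    rw [hV] at hu hv
    refine ⟨⟨g * u + h * v, ?_⟩, ?_, ?_⟩
    · rw [hV]
      refine (totalDegree_add _ _).trans (max_le ?_ ?_)
      · exact (totalDegree_mul _ _).trans (by omega)
      · exact (totalDegree_mul _ _).trans (by omega)
    · ext p
      rw [hψ]
      simp [hS p.1 p.2]
    · simp [hφ]
  have hg0 : g ≠ 0 := hg.ne_zero
  have hker : Module.finrank K (LinearMap.ker φ) ≤ Module.finrank K (V e) := by
    let χ : V e →ₗ[K] V (e + n) × V (e + m) :=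
      ((LinearMap.mulLeft K (-h)).restrict (q := V (e + n)) fun w hw => by
        rw [hV] at hw ⊢
        refine (totalDegree_mul _ _).trans ?_
        rw [totalDegree_neg]
        omega).prod
      ((LinearMap.mulLeft K g).restrict (q := V (e + m)) fun w hw => by
        rw [hV] at hw ⊢
        exact (totalDegree_mul _ _).trans (by omega))
    suffices hle : LinearMap.ker φ ≤ LinearMap.range χ from
      (Submodule.finrank_mono hle).trans (LinearMap.finrank_range_le χ)
    rintro ⟨⟨u, hu⟩, ⟨v, hv⟩⟩ huv
    rw [LinearMap.mem_ker, hφ] at huv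
    simp only at huv
    have hdvd : g ∣ h * v := ⟨-u, by linear_combination huv⟩
    obtain ⟨w, rfl⟩ := (hg.prime.dvd_or_dvd hdvd).resolve_left hgh
    have hu' : u = -h * w := mul_left_cancel₀ hg0 (by linear_combination huv)
    have hw : w ∈ V e := by
      rw [hV] at hv ⊢
      by_cases hw0 : w = 0
      · simp [hw0]
      · rw [totalDegree_mul_of_isDomain hg0 hw0] at hv
        omega
    exact ⟨⟨w, hw⟩, by ext <;> simp [χ, hu']⟩
  have h1 := LinearMap.finrank_range_add_finrank_ker φ
  have h2 := LinearMap.finrank_range_add_finrank_ker ψ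
  have h3 := Submodule.finrank_mono hrange
  rw [Submodule.finrank_map_subtype_eq] at h3
  rw [hψtop, finrank_top, Module.finrank_fintype_fun_eq_card, Fintype.card_coe] at h2
  rw [Module.finrank_prod] at h1
  have d1 := two_mul_finrank_restrictTotalDegree_fin_two K (e + n)
  have d2 := two_mul_finrank_restrictTotalDegree_fin_two K (e + m)
  have d3 := two_mul_finrank_restrictTotalDegree_fin_two K e
  have d4 := two_mul_finrank_restrictTotalDegree_fin_two K (e + m + n)
  simp only [V] at *
  nlinarith

theorem MvPolynomial.totalDegree_bind₁_le {σ τ R : Type*} [CommSemiring R]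
    (φ : σ → MvPolynomial τ R) (hφ : ∀ i, (φ i).totalDegree ≤ 1) (F : MvPolynomial σ R) :
    (bind₁ φ F).totalDegree ≤ F.totalDegree := by
  rw [bind₁, aeval_def, eval₂_eq]
  refine totalDegree_finsetSum_le fun s hs => (totalDegree_mul _ _).trans ?_
  rw [algebraMap_eq, totalDegree_C, zero_add]
  refine (totalDegree_finsetProd _ _).trans ((Finset.sum_le_sum fun i _ => ?_).trans
    (le_totalDegree hs))
  exact (totalDegree_pow _ _).trans (by nlinarith [hφ i])

theorem Polynomial.taylor_coeff_natDegree_sub_one {R : Type*} [CommRing R] (P : Polynomial R)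
    (r : R) {m : ℕ} (hm : P.natDegree = m + 1) :
    (taylor r P).coeff m = P.coeff m + (m + 1) * P.coeff (m + 1) * r := by
  have hlt : (hasseDeriv m P).natDegree < 2 := by
    have := natDegree_hasseDeriv_le P m
    omega
  rw [taylor_coeff, eval_eq_sum_range' hlt, Finset.sum_range_succ, Finset.sum_range_one,
    hasseDeriv_coeff, hasseDeriv_coeff, zero_add, add_comm 1 m, Nat.choose_self,
    Nat.choose_succ_self_right]
  push_cast
  ring

theorem MvPolynomial.finSuccEquiv_bind₁_translate {R : Type*} [CommRing R] (d : R)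
    (F : MvPolynomial (Fin 2) R) :
    finSuccEquiv R 1 (bind₁ ![X 0 + C d, X 1] F) =
      Polynomial.taylor (C d) (finSuccEquiv R 1 F) := by
  have hC (a : R) : finSuccEquiv R 1 (C a) = Polynomial.C (C a) := by
    simp [finSuccEquiv_apply]
  have hX1 : finSuccEquiv R 1 (X 1) = Polynomial.C (X 0) := finSuccEquiv_X_succ (j := 0)
  induction F using MvPolynomial.induction_on with
  | C a => rw [bind₁_C_right, hC, Polynomial.taylor_C]
  | add p q hp hq => simp only [map_add, hp, hq]
  | mul_X p i hp =>
    rw [map_mul, map_mul, map_mul, hp, bind₁_X_right, Polynomial.taylor_mul]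
    fin_cases i
    · simp [finSuccEquiv_X_zero, hC]
    · simp [hX1]

/-- A nonlinear curve `F = c` does not lie in a nontrivial translate, along the first axis, of a
level curve of `F`. -/
theorem MvPolynomial.eq_zero_and_eq_of_sub_C_dvd_translate {K : Type*} [Field K] [CharZero K]
    {F : MvPolynomial (Fin 2) K} (hF : 2 ≤ F.totalDegree) (hdeg : F.degreeOf 1 ≤ F.degreeOf 0)
    {d c c' : K} (h : F - C c ∣ bind₁ ![X 0 + C d, X 1] F - C c') : d = 0 ∧ c = c' := by
  have hsum (s : Fin 2 →₀ ℕ) : (s.sum fun _ e => e) = s 0 + s 1 := by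
    rw [Finsupp.sum_fintype _ _ (fun _ => rfl), Fin.sum_univ_two]
  have hle {s} (hs : s ∈ F.support) (i) : s i ≤ F.degreeOf i := monomial_le_degreeOf i hs
  have hcoeff (s : Fin 2 →₀ ℕ) :
      ((finSuccEquiv K 1 F).coeff (s 0)).coeff s.tail = F.coeff s := by
    rw [finSuccEquiv_coeff_coeff, Finsupp.cons_tail]
  have hPdeg := natDegree_finSuccEquiv (n := 1) F
  have hC (a : K) : finSuccEquiv K 1 (C a) = Polynomial.C (C a) := by
    simp [finSuccEquiv_apply]
  obtain ⟨q, hq⟩ := h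
  replace hq := congrArg (finSuccEquiv K 1) hq
  rw [map_sub, map_mul, map_sub, finSuccEquiv_bind₁_translate, hC, hC] at hq
  set P := finSuccEquiv K 1 F
  set Q := finSuccEquiv K 1 q
  obtain ⟨m, hm⟩ : ∃ m, P.natDegree = m + 1 := by
    refine Nat.exists_eq_succ_of_ne_zero fun h0 => ?_
    have : F.totalDegree ≤ 0 := Finset.sup_le fun s hs => by
      have := hle hs 0
      have := hle hs 1
      rw [hsum]
      omega
    omega
  have hP0 : P.coeff (m + 1) ≠ 0 := by
    rw [← hm, Polynomial.coeff_natDegree, Ne, Polynomial.leadingCoeff_eq_zero]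
    rintro h0
    simp [h0] at hm
  have hPc0 : P - Polynomial.C (C c) ≠ 0 := fun h0 => by
    have := congrArg (fun p => Polynomial.coeff p (m + 1)) h0
    simp [hP0] at this
  have hL : (Polynomial.taylor (C d) P - Polynomial.C (C c')).natDegree = m + 1 := by
    rw [Polynomial.natDegree_sub_C, Polynomial.natDegree_taylor, hm]
  have hQ0 : Q ≠ 0 := by
    rintro h0
    rw [hq, h0] at hL
    simp at hL
  have hQdeg : Q.natDegree = 0 := by
    rw [hq, Polynomial.natDegree_mul hPc0 hQ0, Polynomial.natDegree_sub_C, hm] at hL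
    omega
  have hQ1 : Q = 1 := by
    rw [Polynomial.eq_C_of_natDegree_eq_zero hQdeg] at hq ⊢
    have := congrArg (fun p => Polynomial.coeff p (m + 1)) hq
    have ht := Polynomial.coeff_taylor_natDegree (f := P) (r := C d)
    rw [hm, Polynomial.leadingCoeff, hm] at ht
    simp only [Polynomial.coeff_sub, Polynomial.coeff_mul_C, Polynomial.coeff_C, ht,
      Nat.succ_ne_zero, if_false, sub_zero] at this
    rw [mul_left_cancel₀ hP0 (this.symm.trans (mul_one _).symm), Polynomial.C_1]
  rw [hQ1, mul_one] at hq
  by_cases hd : d = 0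
  · refine ⟨hd, ?_⟩
    rw [hd, C_0, Polynomial.taylor_zero, sub_right_inj, Polynomial.C_inj] at hq
    exact (C_injective _ _ hq).symm
  exfalso
  have hm1 : (m + 1 : MvPolynomial (Fin 1) K) * P.coeff (m + 1) * C d =
      (Polynomial.C (C c' - C c)).coeff m := by
    have := congrArg (fun p => Polynomial.coeff p m) hq
    simp only [Polynomial.coeff_sub, Polynomial.taylor_coeff_natDegree_sub_one P (C d) hm] at this
    rw [Polynomial.C_sub, Polynomial.coeff_sub]
    linear_combination this
  rcases Nat.eq_zero_or_pos m with rfl | hmpos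
  · have hlc : P.coeff 1 = C ((c' - c) / d) := by
      have hCd : (C d : MvPolynomial (Fin 1) K) ≠ 0 := by simpa using hd
      apply mul_right_cancel₀ hCd
      rw [← C_mul, div_mul_cancel₀ _ hd, C_sub]
      simpa using hm1
    have : F.totalDegree ≤ 1 := Finset.sup_le fun s hs => by
      have h0 := hle hs 0
      have h1 := hle hs 1
      rw [hsum]
      by_contra hcon
      have hs0 : s 0 = 1 := by omega
      have hs1 : s 1 = 1 := by omega
      have hne := mem_support_iff.mp hs
      rw [← hcoeff, hs0, hlc, coeff_C, if_neg] at hne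
      · exact hne rfl
      · intro h0
        have := congrArg (fun t => t 0) h0
        simp [Finsupp.tail_apply, hs1] at this
    omega
  · rw [Polynomial.coeff_C, if_neg hmpos.ne'] at hm1
    have hm0 : (m + 1 : MvPolynomial (Fin 1) K) ≠ 0 := by exact_mod_cast Nat.succ_ne_zero m
    have hCd : (C d : MvPolynomial (Fin 1) K) ≠ 0 := by simpa using hd
    exact mul_ne_zero (mul_ne_zero hm0 hP0) hCd hm1

/-- Key intermediate claim via Bezout: if `f − y₀` and `f − y₀′` are irreducible in
`ℂ[x,y]` and `(x₀,y₀) ≠ (x₀′,y₀′)`, then at most `k²` pairs `(a,b)` satisfy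
`f(x₀ − a, b) = y₀` and `f(x₀′ − a, b) = y₀′`. -/
theorem bezout_bound_pairs (k : ℕ) (hk : 2 ≤ k)
    (f : MvPolynomial (Fin 2) ℝ) (hdeg : f.totalDegree = k)
    (hxy : f.degreeOf 1 ≤ f.degreeOf 0)
    (x₀ y₀ x₀' y₀' : ℝ) (hne : (x₀, y₀) ≠ (x₀', y₀'))
    (hirr : Irreducible
      (MvPolynomial.map (algebraMap ℝ ℂ) f - MvPolynomial.C ((y₀ : ℂ))))
    (hirr' : Irreducible
      (MvPolynomial.map (algebraMap ℝ ℂ) f - MvPolynomial.C ((y₀' : ℂ)))) :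
    ({p : ℝ × ℝ | MvPolynomial.eval ![x₀ - p.1, p.2] f = y₀ ∧
        MvPolynomial.eval ![x₀' - p.1, p.2] f = y₀'}).Finite ∧
    ({p : ℝ × ℝ | MvPolynomial.eval ![x₀ - p.1, p.2] f = y₀ ∧
        MvPolynomial.eval ![x₀' - p.1, p.2] f = y₀'}).ncard ≤ k ^ 2 := by
  set S := {p : ℝ × ℝ | MvPolynomial.eval ![x₀ - p.1, p.2] f = y₀ ∧
    MvPolynomial.eval ![x₀' - p.1, p.2] f = y₀'} with hS
  set F := MvPolynomial.map (algebraMap ℝ ℂ) f with hF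
  have hFdeg : F.totalDegree = k := by
    rw [hF, MvPolynomial.totalDegree,
      MvPolynomial.support_map_of_injective _ (algebraMap ℝ ℂ).injective]
    exact hdeg
  have hFxy : F.degreeOf 1 ≤ F.degreeOf 0 := by
    simpa only [hF, MvPolynomial.degreeOf,
      MvPolynomial.degrees_map_of_injective _ (algebraMap ℝ ℂ).injective] using hxy
  have hFeval (a b : ℝ) : MvPolynomial.eval ![(a : ℂ), (b : ℂ)] F =
      (MvPolynomial.eval ![a, b] f : ℝ) := by
    have hv : ![(a : ℂ), (b : ℂ)] = algebraMap ℝ ℂ ∘ ![a, b] := by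
      ext i
      fin_cases i <;> rfl
    rw [hF, MvPolynomial.eval_map, hv, ← MvPolynomial.eval₂_comp]
    rfl
  set d : ℂ := ((x₀' - x₀ : ℝ) : ℂ) with hd
  set G := F - MvPolynomial.C (y₀ : ℂ) with hG
  set H := MvPolynomial.bind₁ ![MvPolynomial.X 0 + MvPolynomial.C d, MvPolynomial.X 1] F -
    (MvPolynomial.C (y₀' : ℂ) : MvPolynomial (Fin 2) ℂ) with hH
  have hGH : ¬ G ∣ H := fun h => by
    obtain ⟨h0, h1⟩ :=
      MvPolynomial.eq_zero_and_eq_of_sub_C_dvd_translate (hFdeg ▸ hk) hFxy h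
    rw [hd, Complex.ofReal_eq_zero] at h0
    exact hne (Prod.ext (sub_eq_zero.mp h0).symm (Complex.ofReal_injective h1))
  have hGdeg : G.totalDegree = k := by
    rw [hG, sub_eq_add_neg, ← MvPolynomial.C_neg,
      MvPolynomial.totalDegree_add_eq_left_of_totalDegree_lt, hFdeg]
    rw [MvPolynomial.totalDegree_C, hFdeg]
    omega
  have hHdeg : H.totalDegree ≤ k := by
    rw [hH, sub_eq_add_neg, ← MvPolynomial.C_neg]
    refine (MvPolynomial.totalDegree_add _ _).trans (max_le ?_ (by simp))
    rw [← hFdeg]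
    refine MvPolynomial.totalDegree_bind₁_le _ (fun i => ?_) F
    fin_cases i
    · exact (MvPolynomial.totalDegree_add _ _).trans (by simp)
    · simp
  let ι : ℝ × ℝ → (Fin 2 → ℂ) := fun p => ![((x₀ - p.1 : ℝ) : ℂ), (p.2 : ℂ)]
  have hι : Function.Injective ι := fun p q hpq => by
    have h0 := Complex.ofReal_injective (congrFun hpq 0)
    have h1 := Complex.ofReal_injective (congrFun hpq 1)
    exact Prod.ext (sub_right_injective h0) h1
  have hzero : ∀ p ∈ S, MvPolynomial.eval (ι p) G = 0 ∧ MvPolynomial.eval (ι p) H = 0 := by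
    rintro p ⟨hp, hp'⟩
    constructor
    · rw [hG, map_sub, hFeval, hp, MvPolynomial.eval_C, sub_self]
    · have hv : (fun i => MvPolynomial.eval (ι p) ((![MvPolynomial.X 0 + MvPolynomial.C d,
          MvPolynomial.X 1] : Fin 2 → MvPolynomial (Fin 2) ℂ) i)) =
          ![((x₀' - p.1 : ℝ) : ℂ), (p.2 : ℂ)] := by
        ext i
        fin_cases i <;> simp [ι, hd]
      rw [hH, map_sub, MvPolynomial.eval_C, ← MvPolynomial.coe_aeval_eq_eval, RingHom.coe_coe,
        MvPolynomial.aeval_bind₁]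
      simp only [MvPolynomial.aeval_eq_eval]
      rw [hv, hFeval, hp', sub_self]
  have hbound : ∀ T : Finset (ℝ × ℝ), (T : Set (ℝ × ℝ)) ⊆ S → T.card ≤ k ^ 2 := by
    intro T hT
    classical
    rw [← Finset.card_image_of_injective T hι, sq]
    refine MvPolynomial.card_common_zeros_le_of_irreducible hirr hGdeg hHdeg hGH _ ?_
    intro p hp
    obtain ⟨t, ht, rfl⟩ := Finset.mem_image.mp hp
    exact hzero t (hT ht)
  have hfin : S.Finite := by
    by_contra hinf
    obtain ⟨T, hT, hcard⟩ := Set.Infinite.exists_subset_card_eq hinf (k ^ 2 + 1)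
    have := hbound T hT
    omega
  refine ⟨hfin, ?_⟩
  rw [Set.ncard_eq_toFinset_card S hfin]
  exact hbound _ (by simp)
end
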